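/- Let K be an algebraically closed field, Q the quiver with two vertices 1, 2, one arrow μ: 1→2 and one loop β at vertex 2, and Λ = KQ/(β^ℓ). If ℓ ≥ 4, then Λ is τ-tilting infinite. -/

import Mathlib

/-!
Core definitions for τ-tilting theory of finite dimensional algebras.

Throughout, for an algebra `Λ`, *right* `Λ`-modules are formalized as left modules
over the opposite ring `Λᵐᵒᵖ` (the category `RMod Λ := ModuleCat Λᵐᵒᵖ`).

τ-rigidity is formalized via the standard projective-presentation criterion of
Auslander–Smalø/Adachi–Iyama–Reiten: a finitely generated module `M` is τ-rigid iff it admits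
a (finite) projective presentation `P₁ → P₀ → M → 0` such that
`Hom(P₀, M) → Hom(P₁, M)` is surjective.
-/

noncomputable section

namespace TwoPoint

/-- A module is indecomposable if it is nonzero and admits no nontrivial direct sum
decomposition. -/
def IsIndecModule (R : Type) [Ring R] (M : Type) [AddCommGroup M] [Module R M] : Prop :=
  Nontrivial M ∧ ∀ N₁ N₂ : Submodule R M, IsCompl N₁ N₂ → N₁ = ⊥ ∨ N₂ = ⊥

/-- `M` decomposes as a finite direct sum of indecomposable submodules having exactly `n`
isomorphism classes. -/
def HasIndecClassCount (R : Type) [Ring R] (M : ModuleCat.{0} R) (n : ℕ) : Prop :=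
  ∃ (k : ℕ) (N : Fin k → Submodule R M),
    DirectSum.IsInternal N ∧ (∀ i, IsIndecModule R (N i)) ∧
    ∃ c : Fin k → Fin n, Function.Surjective c ∧
      ∀ i j, (c i = c j ↔ Nonempty ((N i) ≃ₗ[R] (N j)))

/-- `M` is basic: it decomposes as a finite direct sum of pairwise nonisomorphic
indecomposable submodules. -/
def IsBasicModuleCat (R : Type) [Ring R] (M : ModuleCat.{0} R) : Prop :=
  ∃ (k : ℕ) (N : Fin k → Submodule R M),
    DirectSum.IsInternal N ∧ (∀ i, IsIndecModule R (N i)) ∧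
    ∀ i j, i ≠ j → IsEmpty ((N i) ≃ₗ[R] (N j))

/-- τ-rigidity, via the projective presentation criterion: there is a finite projective
presentation `P₁ —f→ P₀ —g→ M → 0` such that `Hom(—, M)` applied to `f` is surjective,
i.e. `Hom_Λ(M, τM) = 0`. -/
def IsTauRigidCat (R : Type) [Ring R] (M : ModuleCat.{0} R) : Prop :=
  Module.Finite R M ∧
  ∃ (P₁ P₀ : ModuleCat.{0} R) (f : P₁ →ₗ[R] P₀) (g : P₀ →ₗ[R] M),
    Module.Finite R P₁ ∧ Module.Projective R P₁ ∧
    Module.Finite R P₀ ∧ Module.Projective R P₀ ∧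
    Function.Surjective g ∧ LinearMap.range f = LinearMap.ker g ∧
    ∀ h : P₁ →ₗ[R] M, ∃ h' : P₀ →ₗ[R] M, h = h'.comp f

/-- Support τ-tilting module, via support τ-tilting pairs `(M, P)` (Adachi–Iyama–Reiten):
`M` is τ-rigid, `P` is finitely generated projective with `Hom(P, M) = 0`, and
`|M| + |P| = |R|` where `|X|` is the number of isomorphism classes of indecomposable
direct summands. -/
def IsSupportTauTiltingCat (R : Type) [Ring R] (M : ModuleCat.{0} R) : Prop :=
  IsTauRigidCat R M ∧
  ∃ (P : ModuleCat.{0} R) (p q r : ℕ),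
    Module.Finite R P ∧ Module.Projective R P ∧
    (∀ f : P →ₗ[R] M, f = 0) ∧
    HasIndecClassCount R M p ∧ HasIndecClassCount R P q ∧
    HasIndecClassCount R (ModuleCat.of R R) r ∧ p + q = r

/-- The category of (finitely generated) right `Λ`-modules, as left `Λᵐᵒᵖ`-modules. -/
abbrev RMod (Λ : Type) [Ring Λ] := ModuleCat.{0} Λᵐᵒᵖ

/-- Basic support τ-tilting right `Λ`-module. -/
def IsBasicSupportTauTilting (Λ : Type) [Ring Λ] (M : RMod Λ) : Prop :=
  IsSupportTauTiltingCat Λᵐᵒᵖ M ∧ IsBasicModuleCat Λᵐᵒᵖ M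

/-- `Λ` is τ-tilting finite: there are only finitely many isomorphism classes of basic
support τ-tilting right `Λ`-modules. -/
def IsTauTiltingFinite (Λ : Type) [Ring Λ] : Prop :=
  ∃ (n : ℕ) (L : Fin n → RMod Λ),
    ∀ M : RMod Λ, IsBasicSupportTauTilting Λ M → ∃ i, Nonempty (M ≃ₗ[Λᵐᵒᵖ] L i)

/-- `Λ` has exactly `n` isomorphism classes of basic support τ-tilting modules. -/
def SupportTauTiltingCount (Λ : Type) [Ring Λ] (n : ℕ) : Prop :=
  ∃ L : Fin n → RMod Λ,
    (∀ i, IsBasicSupportTauTilting Λ (L i)) ∧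
    (∀ i j, Nonempty ((L i) ≃ₗ[Λᵐᵒᵖ] (L j)) → i = j) ∧
    ∀ M : RMod Λ, IsBasicSupportTauTilting Λ M → ∃ i, Nonempty (M ≃ₗ[Λᵐᵒᵖ] L i)

/-- `Fac M ⊆ Fac N`: every factor module of a finite direct sum of copies of `M` is also a
factor module of a finite direct sum of copies of `N`.  This is the partial order on
support τ-tilting modules. -/
def FacLE (Λ : Type) [Ring Λ] (M N : RMod Λ) : Prop :=
  ∀ X : RMod Λ,
    (∃ (k : ℕ) (f : (Fin k → M) →ₗ[Λᵐᵒᵖ] X), Function.Surjective f) →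
    (∃ (k : ℕ) (f : (Fin k → N) →ₗ[Λᵐᵒᵖ] X), Function.Surjective f)

/-- The Hasse quiver of the poset `sτ-tilt Λ` is of type `H_{m,n}`: the poset of
isomorphism classes of basic support τ-tilting modules is isomorphic to the poset
consisting of a greatest element, a least element, and two incomparable chains with `m`
resp. `n` elements in between (hence two directed paths from `Λ` to `0` with `m` resp. `n`
intermediate vertices). -/
def HasseType (Λ : Type) [Ring Λ] (m n : ℕ) : Prop :=
  ∃ T : WithTop (WithBot (Fin m ⊕ Fin n)) → RMod Λ,
    (∀ x, IsBasicSupportTauTilting Λ (T x)) ∧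
    (∀ x y, Nonempty ((T x) ≃ₗ[Λᵐᵒᵖ] (T y)) → x = y) ∧
    (∀ M : RMod Λ, IsBasicSupportTauTilting Λ M → ∃ x, Nonempty (M ≃ₗ[Λᵐᵒᵖ] T x)) ∧
    ∀ x y, x ≤ y ↔ FacLE Λ (T x) (T y)

/-- `Λ` is τ-tilting finite with exactly `N` basic support τ-tilting modules and Hasse
quiver of type `H_{m,n}`. -/
def TauTiltingData (Λ : Type) [Ring Λ] (N m n : ℕ) : Prop :=
  IsTauTiltingFinite Λ ∧ SupportTauTiltingCount Λ N ∧ HasseType Λ m n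

/-- `B` is a factor algebra of `Λ`: there is a surjective `K`-algebra homomorphism
`Λ → B`. -/
def IsFactorAlgebra (K : Type) [CommRing K] (B Λ : Type) [Ring B] [Ring Λ]
    [Algebra K B] [Algebra K Λ] : Prop :=
  ∃ φ : Λ →ₐ[K] B, Function.Surjective φ

/-- `Λ` is a basic algebra: the regular right module decomposes into pairwise
nonisomorphic indecomposables. -/
def IsBasicAlgebra (Λ : Type) [Ring Λ] : Prop :=
  IsBasicModuleCat Λᵐᵒᵖ (ModuleCat.of Λᵐᵒᵖ Λᵐᵒᵖ)

/-- `Λ` is representation-finite: finitely many isomorphism classes of indecomposable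
finitely generated right modules. -/
def IsRepFinite (Λ : Type) [Ring Λ] : Prop :=
  ∃ (n : ℕ) (L : Fin n → RMod Λ), ∀ M : RMod Λ,
    Module.Finite Λᵐᵒᵖ M → IsIndecModule Λᵐᵒᵖ M → ∃ i, Nonempty (M ≃ₗ[Λᵐᵒᵖ] L i)

end TwoPoint

namespace TwoPoint

/-! ### Bound quiver algebras on two-point quivers

A two-point quiver is given by an arrow type `σ` together with source and target functions
`s t : σ → Fin 2`.  The corresponding bound quiver algebra `KQ/I` is presented as the
quotient of the free algebra on the two vertex idempotents and the arrows, by the path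
algebra relations together with the defining relations of `I` (paths are composed from
left to right, so a relation like `αμβ` is the product `α * μ * β`). -/

/-- Generators for the path algebra of a two-point quiver: two vertex idempotents and the
arrows. -/
inductive TPGen (σ : Type) : Type
  | v : Fin 2 → TPGen σ
  | ar : σ → TPGen σ

/-- The vertex idempotent generator. -/
def vtx (K : Type) [Field K] {σ : Type} (i : Fin 2) : FreeAlgebra K (TPGen σ) :=
  FreeAlgebra.ι K (TPGen.v i)

/-- The arrow generator. -/
def arr (K : Type) [Field K] {σ : Type} (a : σ) : FreeAlgebra K (TPGen σ) :=
  FreeAlgebra.ι K (TPGen.ar a)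

/-- The defining relations of a bound quiver algebra on a two-point quiver:
`e_i e_j = δ_{ij} e_i`, `e_1 + e_2 = 1`, `e_{s(a)} a = a = a e_{t(a)}`, together with the
prescribed relations `rels` (each pair `(x, y) ∈ rels` imposes `x = y`). -/
inductive QuivRel (K : Type) [Field K] (σ : Type) (s t : σ → Fin 2)
    (rels : Set (FreeAlgebra K (TPGen σ) × FreeAlgebra K (TPGen σ))) :
    FreeAlgebra K (TPGen σ) → FreeAlgebra K (TPGen σ) → Prop
  | idem (i : Fin 2) : QuivRel K σ s t rels (vtx K i * vtx K i) (vtx K i)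
  | orth (i j : Fin 2) : i ≠ j → QuivRel K σ s t rels (vtx K i * vtx K j) 0
  | vsum : QuivRel K σ s t rels (vtx K 0 + vtx K 1) 1
  | src (a : σ) : QuivRel K σ s t rels (vtx K (s a) * arr K a) (arr K a)
  | tgt (a : σ) : QuivRel K σ s t rels (arr K a * vtx K (t a)) (arr K a)
  | rel (p : FreeAlgebra K (TPGen σ) × FreeAlgebra K (TPGen σ)) :
      p ∈ rels → QuivRel K σ s t rels p.1 p.2

/-- The bound quiver algebra of a two-point quiver with relations `rels`. -/
abbrev BoundQuiverAlgebra (K : Type) [Field K] (σ : Type) (s t : σ → Fin 2)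
    (rels : Set (FreeAlgebra K (TPGen σ) × FreeAlgebra K (TPGen σ))) : Type :=
  RingQuot (QuivRel K σ s t rels)

/-! Concrete two-point quivers used below.  Vertices are `0` ("1") and `1` ("2"). -/

/- Quiver `μ : 1 → 2`, loop `β` at `2`. -/
namespace QA
def s : Fin 2 → Fin 2 := ![0, 1]
def t : Fin 2 → Fin 2 := ![1, 1]
def mu (K : Type) [Field K] : FreeAlgebra K (TPGen (Fin 2)) := arr K (0 : Fin 2)
def be (K : Type) [Field K] : FreeAlgebra K (TPGen (Fin 2)) := arr K (1 : Fin 2)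
end QA

/- Quiver: loop `α` at `1`, `μ : 1 → 2`, loop `β` at `2`. -/
namespace QB
def s : Fin 3 → Fin 2 := ![0, 0, 1]
def t : Fin 3 → Fin 2 := ![0, 1, 1]
def al (K : Type) [Field K] : FreeAlgebra K (TPGen (Fin 3)) := arr K (0 : Fin 3)
def mu (K : Type) [Field K] : FreeAlgebra K (TPGen (Fin 3)) := arr K (1 : Fin 3)
def be (K : Type) [Field K] : FreeAlgebra K (TPGen (Fin 3)) := arr K (2 : Fin 3)
end QB

/- Quiver: `μ : 1 → 2`, loops `β₁, β₂` at `2`. -/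
namespace QC
def s : Fin 3 → Fin 2 := ![0, 1, 1]
def t : Fin 3 → Fin 2 := ![1, 1, 1]
def mu (K : Type) [Field K] : FreeAlgebra K (TPGen (Fin 3)) := arr K (0 : Fin 3)
def b1 (K : Type) [Field K] : FreeAlgebra K (TPGen (Fin 3)) := arr K (1 : Fin 3)
def b2 (K : Type) [Field K] : FreeAlgebra K (TPGen (Fin 3)) := arr K (2 : Fin 3)
end QC

/- Quiver: loop `α` at `1`, `μ : 1 → 2`, `ν : 2 → 1`. -/
namespace QD
def s : Fin 3 → Fin 2 := ![0, 0, 1]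
def t : Fin 3 → Fin 2 := ![0, 1, 0]
def al (K : Type) [Field K] : FreeAlgebra K (TPGen (Fin 3)) := arr K (0 : Fin 3)
def mu (K : Type) [Field K] : FreeAlgebra K (TPGen (Fin 3)) := arr K (1 : Fin 3)
def nu (K : Type) [Field K] : FreeAlgebra K (TPGen (Fin 3)) := arr K (2 : Fin 3)
end QD

/- Quiver: loops `α` at `1` and `β` at `2`, `μ : 1 → 2`, `ν : 2 → 1`. -/
namespace QE
def s : Fin 4 → Fin 2 := ![0, 1, 0, 1]
def t : Fin 4 → Fin 2 := ![0, 1, 1, 0]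
def al (K : Type) [Field K] : FreeAlgebra K (TPGen (Fin 4)) := arr K (0 : Fin 4)
def be (K : Type) [Field K] : FreeAlgebra K (TPGen (Fin 4)) := arr K (1 : Fin 4)
def mu (K : Type) [Field K] : FreeAlgebra K (TPGen (Fin 4)) := arr K (2 : Fin 4)
def nu (K : Type) [Field K] : FreeAlgebra K (TPGen (Fin 4)) := arr K (3 : Fin 4)
end QE

/- Quiver: `μ : 1 → 2`, `ν : 2 → 1`. -/
namespace QF
def s : Fin 2 → Fin 2 := ![0, 1]
def t : Fin 2 → Fin 2 := ![1, 0]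
def mu (K : Type) [Field K] : FreeAlgebra K (TPGen (Fin 2)) := arr K (0 : Fin 2)
def nu (K : Type) [Field K] : FreeAlgebra K (TPGen (Fin 2)) := arr K (1 : Fin 2)
end QF

/- The Kronecker quiver: `μ₁, μ₂ : 1 → 2`. -/
namespace QG
def s : Fin 2 → Fin 2 := ![0, 0]
def t : Fin 2 → Fin 2 := ![1, 1]
end QG

/- Quiver: `μ₁, μ₂ : 1 → 2`, `ν₁, ν₂ : 2 → 1`. -/
namespace QH
def s : Fin 4 → Fin 2 := ![0, 0, 1, 1]
def t : Fin 4 → Fin 2 := ![1, 1, 0, 0]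
def mu1 (K : Type) [Field K] : FreeAlgebra K (TPGen (Fin 4)) := arr K (0 : Fin 4)
def mu2 (K : Type) [Field K] : FreeAlgebra K (TPGen (Fin 4)) := arr K (1 : Fin 4)
def nu1 (K : Type) [Field K] : FreeAlgebra K (TPGen (Fin 4)) := arr K (2 : Fin 4)
def nu2 (K : Type) [Field K] : FreeAlgebra K (TPGen (Fin 4)) := arr K (3 : Fin 4)
end QH

/- Quiver: loop `α` at `1`, `μ : 1 → 2`. -/
namespace QI
def s : Fin 2 → Fin 2 := ![0, 0]
def t : Fin 2 → Fin 2 := ![0, 1]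
def al (K : Type) [Field K] : FreeAlgebra K (TPGen (Fin 2)) := arr K (0 : Fin 2)
def mu (K : Type) [Field K] : FreeAlgebra K (TPGen (Fin 2)) := arr K (1 : Fin 2)
end QI

/- Quiver: loops `α₁, α₂` at `1`, `μ : 1 → 2`. -/
namespace QJ
def s : Fin 3 → Fin 2 := ![0, 0, 0]
def t : Fin 3 → Fin 2 := ![0, 0, 1]
def a1 (K : Type) [Field K] : FreeAlgebra K (TPGen (Fin 3)) := arr K (0 : Fin 3)
def a2 (K : Type) [Field K] : FreeAlgebra K (TPGen (Fin 3)) := arr K (1 : Fin 3)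
def mu (K : Type) [Field K] : FreeAlgebra K (TPGen (Fin 3)) := arr K (2 : Fin 3)
end QJ

/- Quiver: `μ₁, μ₂ : 1 → 2`, `ν : 2 → 1`. -/
namespace QK
def s : Fin 3 → Fin 2 := ![0, 0, 1]
def t : Fin 3 → Fin 2 := ![1, 1, 0]
def mu1 (K : Type) [Field K] : FreeAlgebra K (TPGen (Fin 3)) := arr K (0 : Fin 3)
def mu2 (K : Type) [Field K] : FreeAlgebra K (TPGen (Fin 3)) := arr K (1 : Fin 3)
def nu (K : Type) [Field K] : FreeAlgebra K (TPGen (Fin 3)) := arr K (2 : Fin 3)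
end QK

/- Quiver: `μ₁, μ₂, μ₃ : 1 → 2`. -/
namespace QL
def s : Fin 3 → Fin 2 := ![0, 0, 0]
def t : Fin 3 → Fin 2 := ![1, 1, 1]
end QL

/- Quiver: loop `α` at `1`, `μ₁, μ₂ : 1 → 2`. -/
namespace QM
def s : Fin 3 → Fin 2 := ![0, 0, 0]
def t : Fin 3 → Fin 2 := ![0, 1, 1]
def al (K : Type) [Field K] : FreeAlgebra K (TPGen (Fin 3)) := arr K (0 : Fin 3)
def mu1 (K : Type) [Field K] : FreeAlgebra K (TPGen (Fin 3)) := arr K (1 : Fin 3)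
def mu2 (K : Type) [Field K] : FreeAlgebra K (TPGen (Fin 3)) := arr K (2 : Fin 3)
end QM

end TwoPoint

namespace TwoPoint

/-- The algebra `KQ/(βˡ)` where `Q` has two vertices, one arrow `μ : 1 → 2` and one loop
`β` at `2`. -/
abbrev LoopPowerAlgebra (K : Type) [Field K] (l : ℕ) : Type :=
  BoundQuiverAlgebra K (Fin 2) QA.s QA.t {(QA.be K ^ l, 0)}

/-! ### Truncated polynomial modules

`Cofree K m W` is the module of finitely supported sequences `W ⊗ K[β]/(β ^ (m + 1))`, with `β`
acting by the shift; it is both induced and coinduced from the vector space `W`. -/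

section Cofree

variable {K : Type} [Field K] {m : ℕ} {W Q : Type} [AddCommGroup W] [Module K W]
  [AddCommGroup Q] [Module K Q]

/-- Sequences in `W` vanishing beyond degree `m`. -/
def Cofree (K : Type) [Field K] (m : ℕ) (W : Type) [AddCommGroup W] [Module K W] :
    Submodule K (ℕ → W) where
  carrier := {f | ∀ i, m < i → f i = 0}
  add_mem' hf hg i hi := by simp [hf i hi, hg i hi]
  zero_mem' _ _ := rfl
  smul_mem' c f hf i hi := by simp [hf i hi]

namespace Cofree

/-- Evaluation at degree `i`. -/
def coeff (i : ℕ) : Cofree K m W →ₗ[K] W := LinearMap.proj i ∘ₗ (Cofree K m W).subtype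

@[ext] lemma ext_coeff {f g : Cofree K m W} (h : ∀ i, coeff i f = coeff i g) : f = g :=
  Subtype.ext (funext h)

lemma coeff_of_lt (f : Cofree K m W) {i : ℕ} (hi : m < i) : coeff i f = 0 := f.2 i hi

/-- The nilpotent action of the loop. -/
def shift : Module.End K (Cofree K m W) where
  toFun f := ⟨fun i => f.1 (i + 1), fun i hi => f.2 (i + 1) (by omega)⟩
  map_add' _ _ := rfl
  map_smul' _ _ := rfl

@[simp] lemma coeff_shift (f : Cofree K m W) (i : ℕ) :
    coeff i (shift f) = coeff (i + 1) f := rfl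

@[simp] lemma coeff_shift_pow (k : ℕ) (f : Cofree K m W) (i : ℕ) :
    coeff i ((shift ^ k) f) = coeff (i + k) f := by
  induction k generalizing i with
  | zero => rfl
  | succ k ih => rw [pow_succ', Module.End.mul_apply, coeff_shift, ih]; congr 2; omega

lemma shift_pow_eq_zero : (shift : Module.End K (Cofree K m W)) ^ (m + 1) = 0 := by
  ext f i
  rw [coeff_shift_pow, coeff_of_lt _ (by omega)]
  rfl

/-- The inclusion of `W` as generators of `Cofree K m W`. -/
def gen : W →ₗ[K] Cofree K m W :=
  (LinearMap.single K (fun _ : ℕ => W) m).codRestrict _ fun w i hi => by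
    simp [Pi.single_eq_of_ne (show i ≠ m by omega)]

lemma coeff_gen (w : W) (i : ℕ) :
    coeff i (gen w : Cofree K m W) = if i = m then w else 0 := by
  change (Pi.single m w : ℕ → W) i = _
  rw [Pi.single_apply]

/-- The extension of a linear map `W → Q` to a map `Cofree K m W → Q` compatible with a nilpotent
endomorphism `T` of `Q`. -/
def lift (T : Module.End K Q) (φ : W →ₗ[K] Q) : Cofree K m W →ₗ[K] Q :=
  ∑ p ∈ Finset.HasAntidiagonal.antidiagonal m, (T ^ p.2) ∘ₗ φ ∘ₗ coeff p.1

lemma lift_apply (T : Module.End K Q) (φ : W →ₗ[K] Q) (f : Cofree K m W) :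
    lift T φ f = ∑ p ∈ Finset.HasAntidiagonal.antidiagonal m, (T ^ p.2) (φ (coeff p.1 f)) := by
  simp [lift, LinearMap.sum_apply]

lemma lift_shift {T : Module.End K Q} (hT : T ^ (m + 1) = 0) (φ : W →ₗ[K] Q)
    (f : Cofree K m W) : lift T φ (shift f) = T (lift T φ f) := by
  have h₁ := Finset.Nat.sum_antidiagonal_succ (n := m)
    (f := fun p : ℕ × ℕ => (T ^ p.2) (φ (coeff p.1 f)))
  have h₂ := Finset.Nat.sum_antidiagonal_succ' (n := m)
    (f := fun p : ℕ × ℕ => (T ^ p.2) (φ (coeff p.1 f)))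
  rw [h₁] at h₂
  simp only [hT, LinearMap.zero_apply, zero_add, coeff_of_lt f (Nat.lt_succ_self m), map_zero]
    at h₂
  simp only [lift_apply, coeff_shift, map_sum]
  simpa [pow_succ'] using h₂

lemma lift_gen (T : Module.End K Q) (φ : W →ₗ[K] Q) (w : W) :
    lift T φ (gen w : Cofree K m W) = φ w := by
  rw [lift_apply, Finset.sum_eq_single (m, 0)]
  · simp [coeff_gen]
  · rintro ⟨i, k⟩ hp hne
    have : i ≠ m := by
      rintro rfl
      simp_all
    simp [coeff_gen, this]
  · simp

lemma eq_sum_gen (f : Cofree K m W) :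
    f = ∑ p ∈ Finset.HasAntidiagonal.antidiagonal m, (shift ^ p.2) (gen (coeff p.1 f)) := by
  ext t
  simp only [map_sum, coeff_shift_pow, coeff_gen]
  by_cases ht : t ≤ m
  · rw [Finset.sum_eq_single (t, m - t)]
    · simp [ht]
    · rintro ⟨i, k⟩ hp hne
      rw [if_neg]
      rintro h
      simp only [Finset.HasAntidiagonal.mem_antidiagonal] at hp
      apply hne
      ext <;> simp <;> omega
    · simp [ht]
  · rw [coeff_of_lt f (by omega), Finset.sum_eq_zero]
    intro p _
    rw [if_neg (by omega)]

lemma comp_pow {Q' : Type} [AddCommGroup Q'] [Module K Q'] {S : Module.End K Q}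
    {T : Module.End K Q'} {A : Q →ₗ[K] Q'} (h : ∀ x, A (S x) = T (A x)) (k : ℕ) (x : Q) :
    A ((S ^ k) x) = (T ^ k) (A x) := by
  induction k with
  | zero => rfl
  | succ k ih => rw [pow_succ', pow_succ', Module.End.mul_apply, Module.End.mul_apply, h, ih]

lemma eq_lift {T : Module.End K Q} {A : Cofree K m W →ₗ[K] Q}
    (hA : ∀ f, A (shift f) = T (A f)) : A = lift T (A ∘ₗ gen) := by
  ext1 f
  conv_lhs => rw [eq_sum_gen f]
  rw [lift_apply, map_sum]
  exact Finset.sum_congr rfl fun p _ => comp_pow hA _ _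

lemma hom_ext {T : Module.End K Q} {A B : Cofree K m W →ₗ[K] Q}
    (hA : ∀ f, A (shift f) = T (A f)) (hB : ∀ f, B (shift f) = T (B f))
    (h : ∀ w, A (gen w) = B (gen w)) : A = B := by
  rw [eq_lift hA, eq_lift hB]
  congr 1
  ext w
  exact h w

/-- The map into `Cofree K m W` coinduced by a linear map to `W`. -/
def colift (T : Module.End K Q) (hT : T ^ (m + 1) = 0) (q : Q →ₗ[K] W) :
    Q →ₗ[K] Cofree K m W where
  toFun n := ⟨fun i => q ((T ^ i) n), fun i hi => by
    change q ((T ^ i) n) = 0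
    rw [pow_eq_zero_of_le hi hT, LinearMap.zero_apply, map_zero]⟩
  map_add' x y := by ext i; exact (congrArg q (map_add (T ^ i) x y)).trans (map_add _ _ _)
  map_smul' c x := by ext i; exact (congrArg q (map_smul (T ^ i) c x)).trans (map_smul _ _ _)

@[simp] lemma coeff_colift (T : Module.End K Q) (hT : T ^ (m + 1) = 0) (q : Q →ₗ[K] W) (n : Q)
    (i : ℕ) : coeff i (colift T hT q n) = q ((T ^ i) n) := rfl

lemma colift_comm (T : Module.End K Q) (hT : T ^ (m + 1) = 0) (q : Q →ₗ[K] W) (n : Q) :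
    colift T hT q (T n) = shift (colift T hT q n) := by
  ext i
  simp [pow_succ]

lemma coeff_eq_of_comm {T : Module.End K Q} {A : Q →ₗ[K] Cofree K m W}
    (hA : ∀ n, A (T n) = shift (A n)) (n : Q) (i : ℕ) :
    coeff i (A n) = coeff 0 (A ((T ^ i) n)) := by
  rw [comp_pow hA, coeff_shift_pow, zero_add]

/-- Functoriality of `Cofree` in the vector space. -/
def map {W' : Type} [AddCommGroup W'] [Module K W'] (X : W →ₗ[K] W') :
    Cofree K m W →ₗ[K] Cofree K m W' where
  toFun f := ⟨fun i => X (coeff i f), fun i hi => by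
    change X (coeff i f) = 0
    rw [coeff_of_lt f hi, map_zero]⟩
  map_add' x y := by ext i; exact map_add X _ _
  map_smul' c x := by ext i; exact map_smul X _ _

@[simp] lemma coeff_map {W' : Type} [AddCommGroup W'] [Module K W'] (X : W →ₗ[K] W')
    (f : Cofree K m W) (i : ℕ) : coeff i (map X f) = X (coeff i f) := rfl

lemma map_shift {W' : Type} [AddCommGroup W'] [Module K W'] (X : W →ₗ[K] W')
    (f : Cofree K m W) : map X (shift f) = shift (map X f) := rfl

lemma map_gen {W' : Type} [AddCommGroup W'] [Module K W'] (X : W →ₗ[K] W') (w : W) :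
    map X (gen w : Cofree K m W) = gen (X w) := by
  ext i
  simp only [coeff_map, coeff_gen]
  split_ifs <;> simp

/-- `Cofree K m W` is a sum of `m + 1` copies of `W`. -/
def equivFun : Cofree K m W ≃ₗ[K] (Fin (m + 1) → W) where
  toFun f i := coeff i f
  map_add' _ _ := rfl
  map_smul' _ _ := rfl
  invFun g := ⟨fun i => if h : i < m + 1 then g ⟨i, h⟩ else 0, fun i hi =>
    dif_neg (by omega)⟩
  left_inv f := by
    ext i
    change (if h : i < m + 1 then coeff i f else 0) = _
    split_ifs with h
    · rfl
    · exact (coeff_of_lt f (by omega)).symm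
  right_inv g := by
    ext i
    change (if h : (i : ℕ) < m + 1 then g ⟨i, h⟩ else 0) = _
    rw [dif_pos i.2]

instance [FiniteDimensional K W] : FiniteDimensional K (Cofree K m W) :=
  Module.Finite.equiv (equivFun (K := K) (m := m) (W := W)).symm

lemma finrank_eq [FiniteDimensional K W] :
    Module.finrank K (Cofree K m W) = (m + 1) * Module.finrank K W := by
  rw [equivFun.finrank_eq, Module.finrank_pi_fintype]
  simp

end Cofree

end Cofree

/-! ### Representations of the loop quiver and their inverse Auslander–Reiten translate -/

/-- A linear map vanishing on the kernel of a surjection factors through it. -/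
lemma exists_factor {K A B C : Type} [Field K] [AddCommGroup A] [Module K A] [AddCommGroup B]
    [Module K B] [AddCommGroup C] [Module K C] {q : A →ₗ[K] B} (hq : Function.Surjective q)
    (f : A →ₗ[K] C) (h : ∀ x, q x = 0 → f x = 0) : ∃ g : B →ₗ[K] C, ∀ x, g (q x) = f x := by
  obtain ⟨s, hs⟩ := LinearMap.exists_rightInverse_of_surjective q (LinearMap.range_eq_top.2 hq)
  refine ⟨f ∘ₗ s, fun x => ?_⟩
  rw [LinearMap.comp_apply, ← sub_eq_zero, ← map_sub]
  apply h
  rw [map_sub, sub_eq_zero]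
  exact LinearMap.congr_fun hs (q x)

/-- A linear map with values in the range of an injection factors through it. -/
lemma exists_cofactor {K A B C : Type} [Field K] [AddCommGroup A] [Module K A] [AddCommGroup B]
    [Module K B] [AddCommGroup C] [Module K C] {i : A →ₗ[K] B} (hi : Function.Injective i)
    (f : C →ₗ[K] B) (h : ∀ x, ∃ y, i y = f x) : ∃ g : C →ₗ[K] A, ∀ x, i (g x) = f x := by
  obtain ⟨p, hp⟩ := LinearMap.exists_leftInverse_of_injective i (LinearMap.ker_eq_bot.2 hi)
  refine ⟨p ∘ₗ f, fun x => ?_⟩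
  obtain ⟨y, hy⟩ := h x
  rw [LinearMap.comp_apply, ← hy]
  exact congrArg i (LinearMap.congr_fun hp y)

/-- A finite dimensional representation of the quiver `1 → 2` with a nilpotent loop at `2`. -/
structure LoopRep (K : Type) [Field K] (m : ℕ) where
  /-- The space at vertex `1`. -/
  V : Type
  /-- The space at vertex `2`. -/
  N : Type
  [addV : AddCommGroup V]
  [modV : Module K V]
  [finV : FiniteDimensional K V]
  [addN : AddCommGroup N]
  [modN : Module K N]
  [finN : FiniteDimensional K N]
  /-- The loop. -/
  β : Module.End K N
  β_pow : β ^ (m + 1) = 0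
  /-- The arrow. -/
  j : V →ₗ[K] N

namespace LoopRep

attribute [instance] addV modV finV addN modN finN

variable {K : Type} [Field K] {m : ℕ}

/-- The representation with space `W` at vertex `1` freely generating the space at vertex `2`. -/
def free (K : Type) [Field K] (m : ℕ) (W : Type) [AddCommGroup W] [Module K W]
    [FiniteDimensional K W] : LoopRep K m where
  V := W
  N := Cofree K m W
  β := Cofree.shift
  β_pow := Cofree.shift_pow_eq_zero
  j := Cofree.gen

/-- The representation obtained by forgetting the space at vertex `1`. -/
def tail (M : LoopRep K m) : LoopRep K m where
  V := PUnit
  N := M.N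
  β := M.β
  β_pow := M.β_pow
  j := 0

/-- `M₁` is the inverse Auslander–Reiten translate of `M`: the space at vertex `1` is the cokernel
of the arrow of `M`, the one at vertex `2` the cokernel of the coinduced map. -/
structure Translate (M M₁ : LoopRep K m) where
  /-- The projection onto the cokernel of the arrow. -/
  q : M.N →ₗ[K] M₁.V
  q_surjective : Function.Surjective q
  q_eq_zero_iff : ∀ n, q n = 0 ↔ ∃ v, M.j v = n
  /-- The free cover. -/
  π : Cofree K m M₁.V →ₗ[K] M₁.N
  π_surjective : Function.Surjective π
  π_shift : ∀ f, π (Cofree.shift f) = M₁.β (π f)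
  π_gen : ∀ v, π (Cofree.gen v) = M₁.j v
  π_eq_zero_iff : ∀ f, π f = 0 ↔ ∃ n, Cofree.colift M.β M.β_pow q n = f

/-- The coinduced map into the free cover of the translate. -/
def Translate.ι {M M₁ : LoopRep K m} (t : Translate M M₁) : M.N →ₗ[K] Cofree K m M₁.V :=
  Cofree.colift M.β M.β_pow t.q

lemma exists_translate (M : LoopRep K m) : ∃ M₁ : LoopRep K m, Nonempty (Translate M M₁) := by
  let ι : M.N →ₗ[K] Cofree K m (M.N ⧸ LinearMap.range M.j) :=
    Cofree.colift M.β M.β_pow (LinearMap.range M.j).mkQ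
  have hβ : ∀ x, (LinearMap.range ι).mkQ x = 0 →
      ((LinearMap.range ι).mkQ ∘ₗ Cofree.shift) x = 0 := by
    intro x hx
    obtain ⟨n, rfl⟩ := (Submodule.Quotient.mk_eq_zero _).1 hx
    rw [LinearMap.comp_apply, ← Cofree.colift_comm]
    exact (Submodule.Quotient.mk_eq_zero _).2 ⟨_, rfl⟩
  obtain ⟨β, h⟩ := exists_factor (Submodule.mkQ_surjective _) _ hβ
  refine ⟨⟨M.N ⧸ LinearMap.range M.j, Cofree K m (M.N ⧸ LinearMap.range M.j) ⧸ LinearMap.range ι,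
    β, ?_, (LinearMap.range ι).mkQ ∘ₗ Cofree.gen⟩, ⟨⟨(LinearMap.range M.j).mkQ,
    Submodule.mkQ_surjective _, fun n => Submodule.Quotient.mk_eq_zero _,
    (LinearMap.range ι).mkQ, Submodule.mkQ_surjective _, fun f => (h f).symm, fun _ => rfl,
    fun f => Submodule.Quotient.mk_eq_zero _⟩⟩⟩
  refine LinearMap.ext fun x => ?_
  obtain ⟨f, rfl⟩ := Submodule.mkQ_surjective _ x
  rw [← Cofree.comp_pow (fun x => (h x).symm), Cofree.shift_pow_eq_zero]
  simp

/-- The space at vertex `2` is a retract of a free one, i.e. is projective over the loop. -/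
def IsRetract (M : LoopRep K m) : Prop :=
  ∃ (W : Type) (_ : AddCommGroup W) (_ : Module K W) (i : M.N →ₗ[K] Cofree K m W)
    (r : Cofree K m W →ₗ[K] M.N), (∀ n, i (M.β n) = Cofree.shift (i n)) ∧
    (∀ f, r (Cofree.shift f) = M.β (r f)) ∧ ∀ n, r (i n) = n

/-- No nonzero vector of `V` is mapped by the loop into `V`. -/
def IsSeparated (M : LoopRep K m) : Prop := ∀ w w', M.β (M.j w) = M.j w' → w = 0

/-- The vanishing of `Ext¹(M, M')`, for `M` projective over the loop. -/
def ExtVanish (M M' : LoopRep K m) : Prop :=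
  ∀ h : M.V →ₗ[K] M'.N, ∃ (X : M.V →ₗ[K] M'.V) (Y : M.N →ₗ[K] M'.N),
    (∀ n, Y (M.β n) = M'.β (Y n)) ∧ ∀ v, h v = M'.j (X v) + Y (M.j v)

/-- Every idempotent endomorphism is trivial. -/
def IdempotentsTrivial (M : LoopRep K m) : Prop :=
  ∀ (X : Module.End K M.V) (Y : Module.End K M.N), (∀ n, Y (M.β n) = M.β (Y n)) →
    (∀ v, Y (M.j v) = M.j (X v)) → (∀ v, X (X v) = X v) → (∀ n, Y (Y n) = Y n) →
    (X = 0 ∧ Y = 0) ∨ (X = 1 ∧ Y = 1)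

variable {M M' M₁ M₁' : LoopRep K m}

namespace Translate

lemma coeff_ι (t : Translate M M₁) (n : M.N) (i : ℕ) :
    Cofree.coeff i (t.ι n) = t.q ((M.β ^ i) n) := rfl

lemma ι_β (t : Translate M M₁) (n : M.N) : t.ι (M.β n) = Cofree.shift (t.ι n) :=
  Cofree.colift_comm _ _ _ _

lemma π_ι (t : Translate M M₁) (n : M.N) : t.π (t.ι n) = 0 := (t.π_eq_zero_iff _).2 ⟨n, rfl⟩

lemma exists_ι_eq (t : Translate M M₁) {f : Cofree K m M₁.V} (hf : t.π f = 0) :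
    ∃ n, t.ι n = f := (t.π_eq_zero_iff f).1 hf

end Translate

lemma IsSeparated.j_injective (hM : M.IsSeparated) : Function.Injective M.j := by
  rw [injective_iff_map_eq_zero]
  intro w hw
  exact hM w 0 (by simp [hw])

lemma IsSeparated.eq_zero (hM : M.IsSeparated) {n : M.N} (h₀ : ∃ v, M.j v = n)
    (h₁ : ∃ v, M.j v = M.β n) : n = 0 := by
  obtain ⟨w, rfl⟩ := h₀
  obtain ⟨w', hw'⟩ := h₁
  rw [hM w w' hw'.symm, map_zero]

lemma IsSeparated.ι_injective (hM : M.IsSeparated) (t : Translate M M₁) :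
    Function.Injective t.ι := by
  rw [injective_iff_map_eq_zero]
  intro n hn
  have h (i : ℕ) : ∃ v, M.j v = (M.β ^ i) n := by
    rw [← t.q_eq_zero_iff, ← t.coeff_ι, hn, map_zero]
  exact hM.eq_zero (h 0) (by simpa using h 1)

lemma IsSeparated.translate (hM : M.IsSeparated) (hm : 3 ≤ m) (t : Translate M M₁) :
    M₁.IsSeparated := by
  intro v v' h
  obtain ⟨n, hn⟩ := t.exists_ι_eq (f := Cofree.shift (Cofree.gen v) - Cofree.gen v')
    (by rw [map_sub, t.π_shift, t.π_gen, t.π_gen, h, sub_self])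
  have hc (i : ℕ) := congrArg (Cofree.coeff i) hn
  simp only [t.coeff_ι, map_sub, Cofree.coeff_shift, Cofree.coeff_gen] at hc
  have hr (i : ℕ) (hi : i + 1 < m) : ∃ v, M.j v = (M.β ^ i) n := by
    rw [← t.q_eq_zero_iff, hc, if_neg (by omega), if_neg (by omega), sub_zero]
  have hn0 : n = 0 := hM.eq_zero (hr 0 (by omega)) (by simpa using hr 1 (by omega))
  have := hc (m - 1)
  rw [if_pos (by omega), if_neg (by omega), hn0, map_zero, map_zero, sub_zero] at this
  exact this.symm

lemma IsRetract.exists_section (hM : M.IsRetract) (hs : M.IsSeparated) (t : Translate M M₁) :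
    ∃ σ : M₁.N →ₗ[K] Cofree K m M₁.V, (∀ n, σ (M₁.β n) = Cofree.shift (σ n)) ∧
      ∀ n, t.π (σ n) = n := by
  obtain ⟨W, _, _, i, r, hi, hr, hri⟩ := hM
  obtain ⟨p, hp⟩ := LinearMap.exists_leftInverse_of_injective t.ι
    (LinearMap.ker_eq_bot.2 (hs.ι_injective t))
  let ρ : Cofree K m M₁.V →ₗ[K] M.N :=
    r ∘ₗ Cofree.colift Cofree.shift Cofree.shift_pow_eq_zero (Cofree.coeff 0 ∘ₗ i ∘ₗ p)
  have hρ_shift (f) : ρ (Cofree.shift f) = M.β (ρ f) := by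
    simp only [ρ, LinearMap.comp_apply, Cofree.colift_comm, hr]
  have hρ_ι (n) : ρ (t.ι n) = n := by
    have : Cofree.colift Cofree.shift Cofree.shift_pow_eq_zero (Cofree.coeff 0 ∘ₗ i ∘ₗ p)
        (t.ι n) = i n := by
      ext k
      rw [Cofree.coeff_colift, Cofree.coeff_eq_of_comm hi, ← Cofree.comp_pow t.ι_β]
      simp only [LinearMap.comp_apply]
      rw [show p (t.ι ((M.β ^ k) n)) = (M.β ^ k) n from LinearMap.congr_fun hp _]
    exact (congrArg r this).trans (hri n)
  obtain ⟨σ, hσ⟩ := exists_factor t.π_surjective (LinearMap.id - t.ι ∘ₗ ρ) (fun f hf => by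
    obtain ⟨n, rfl⟩ := t.exists_ι_eq hf
    simp [hρ_ι])
  simp only [LinearMap.sub_apply, LinearMap.comp_apply, LinearMap.id_apply] at hσ
  refine ⟨σ, fun n => ?_, fun n => ?_⟩ <;> obtain ⟨f, rfl⟩ := t.π_surjective n
  · rw [← t.π_shift, hσ, hσ, hρ_shift, t.ι_β, map_sub]
  · rw [hσ, map_sub, t.π_ι, sub_zero]

lemma IsRetract.translate (hM : M.IsRetract) (hs : M.IsSeparated) (t : Translate M M₁) :
    M₁.IsRetract := by
  obtain ⟨σ, h₁, h₂⟩ := hM.exists_section hs t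
  exact ⟨M₁.V, inferInstance, inferInstance, σ, t.π, h₁, t.π_shift, h₂⟩

lemma ExtVanish.exists_eq (h : ExtVanish M M') (hM' : M'.IsRetract) (hs' : M'.IsSeparated)
    (t : Translate M M₁) (t' : Translate M' M₁')
    (g : M.N →ₗ[K] M₁'.N) (hg : ∀ n, g (M.β n) = M₁'.β (g n)) :
    ∃ X : M₁.V →ₗ[K] M₁'.V, ∀ n, g n = t'.π (Cofree.map X (t.ι n)) := by
  obtain ⟨σ, hσ, hσπ⟩ := hM'.exists_section hs' t'
  obtain ⟨s, hs⟩ := LinearMap.exists_rightInverse_of_surjective t'.q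
    (LinearMap.range_eq_top.2 t'.q_surjective)
  have hs (x) : t'.q (s x) = x := LinearMap.congr_fun hs x
  let k : M.N →ₗ[K] M'.N := s ∘ₗ Cofree.coeff 0 ∘ₗ σ ∘ₗ g
  obtain ⟨X, Y, hY, hXY⟩ := h (k ∘ₗ M.j)
  obtain ⟨X₁, hX₁⟩ := exists_factor t.q_surjective (t'.q ∘ₗ (k - Y)) (fun n hn => by
    obtain ⟨v, rfl⟩ := (t.q_eq_zero_iff n).1 hn
    rw [LinearMap.comp_apply, t'.q_eq_zero_iff]
    refine ⟨X v, ?_⟩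
    have := hXY v
    rw [LinearMap.comp_apply] at this
    rw [LinearMap.sub_apply, this, add_sub_cancel_right])
  have hX₁ (n) : X₁ (t.q n) = t'.q (k n) - t'.q (Y n) := (hX₁ n).trans (map_sub t'.q _ _)
  refine ⟨X₁, fun n => ?_⟩
  have key : σ (g n) - Cofree.map X₁ (t.ι n) = t'.ι (Y n) := by
    ext i
    have h₁ : Cofree.coeff i (σ (g n)) = t'.q (k ((M.β ^ i) n)) := by
      have := Cofree.coeff_eq_of_comm (A := σ ∘ₗ g) (T := M.β) (fun n => by
        rw [LinearMap.comp_apply, hg, hσ, LinearMap.comp_apply]) n i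
      exact this.trans (hs _).symm
    rw [map_sub, h₁, Cofree.coeff_map, t.coeff_ι, hX₁, t'.coeff_ι, ← Cofree.comp_pow hY,
      sub_sub_cancel]
  rw [← hσπ (g n), sub_eq_iff_eq_add.1 key, map_add, t'.π_ι, zero_add]

lemma ExtVanish.translate (h : ExtVanish M M') (hM' : M'.IsRetract) (hs' : M'.IsSeparated)
    (t : Translate M M₁) (t' : Translate M' M₁') : ExtVanish M₁ M₁' := by
  intro g
  have hlift := Cofree.lift_shift (T := M₁'.β) M₁'.β_pow g
  obtain ⟨X, hX⟩ := h.exists_eq hM' hs' t t' (Cofree.lift M₁'.β g ∘ₗ t.ι) (fun n => by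
    rw [LinearMap.comp_apply, t.ι_β, hlift, LinearMap.comp_apply])
  obtain ⟨Y, hY⟩ := exists_factor t.π_surjective
    (Cofree.lift M₁'.β g - t'.π ∘ₗ Cofree.map X) (fun f hf => by
      obtain ⟨n, rfl⟩ := t.exists_ι_eq hf
      rw [LinearMap.sub_apply, sub_eq_zero]
      exact hX n)
  simp only [LinearMap.sub_apply, LinearMap.comp_apply] at hY
  refine ⟨X, Y, fun n => ?_, fun v => ?_⟩
  · obtain ⟨f, rfl⟩ := t.π_surjective n
    rw [← t.π_shift, hY, hY, hlift, Cofree.map_shift, t'.π_shift, map_sub]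
  · rw [← t.π_gen, hY, Cofree.lift_gen, Cofree.map_gen, t'.π_gen, add_sub_cancel]

lemma IdempotentsTrivial.translate (h : M.IdempotentsTrivial) (hs : M.IsSeparated)
    (t : Translate M M₁) : M₁.IdempotentsTrivial := by
  intro X₁ Y₁ hβ hj hX₁ hY₁
  have hY₁π : Y₁ ∘ₗ t.π = t.π ∘ₗ Cofree.map X₁ := by
    refine Cofree.hom_ext (T := M₁.β) (fun f => ?_) (fun f => ?_) (fun v => ?_)
    · rw [LinearMap.comp_apply, t.π_shift, hβ, LinearMap.comp_apply]
    · rw [LinearMap.comp_apply, Cofree.map_shift, t.π_shift, LinearMap.comp_apply]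
    · rw [LinearMap.comp_apply, t.π_gen, hj, LinearMap.comp_apply, Cofree.map_gen, t.π_gen]
  have hY₁π (f) : Y₁ (t.π f) = t.π (Cofree.map X₁ f) := LinearMap.congr_fun hY₁π f
  obtain ⟨Y, hY⟩ := exists_cofactor (hs.ι_injective t) (Cofree.map X₁ ∘ₗ t.ι) (fun n =>
    t.exists_ι_eq (by rw [LinearMap.comp_apply, ← hY₁π, t.π_ι, map_zero]))
  have hYq (n) : t.q (Y n) = X₁ (t.q n) := congrArg (Cofree.coeff 0) (hY n)
  obtain ⟨X, hX⟩ := exists_cofactor hs.j_injective (Y ∘ₗ M.j) (fun v => by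
    rw [← t.q_eq_zero_iff, LinearMap.comp_apply, hYq, (t.q_eq_zero_iff _).2 ⟨v, rfl⟩, map_zero])
  simp only [LinearMap.comp_apply] at hX hY
  have hYY (n) : Y (Y n) = Y n := by
    apply hs.ι_injective t
    rw [hY, hY]
    ext i
    exact hX₁ _
  have hYβ (n) : Y (M.β n) = M.β (Y n) := by
    apply hs.ι_injective t
    rw [hY, t.ι_β, t.ι_β, hY, Cofree.map_shift]
  have hXX (v) : X (X v) = X v := by
    apply hs.j_injective
    rw [hX, hX, hYY]
  have hY₁X (c : K) (hc : X₁ = c • 1) : Y₁ = c • 1 := by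
    ext n
    obtain ⟨f, rfl⟩ := t.π_surjective n
    have : Cofree.map X₁ f = c • f := by ext i; simp [hc]
    rw [hY₁π, this, map_smul]
    rfl
  rcases h X Y hYβ (fun v => (hX v).symm) hXX hYY with ⟨-, h0⟩ | ⟨-, h1⟩
  · left
    have : X₁ = 0 := by
      ext x
      obtain ⟨n, rfl⟩ := t.q_surjective x
      rw [← hYq, h0]
      simp
    exact ⟨this, by simpa using hY₁X 0 (by simpa using this)⟩
  · right
    have : X₁ = 1 := by
      ext x
      obtain ⟨n, rfl⟩ := t.q_surjective x
      rw [← hYq, h1]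
      rfl
    exact ⟨this, by simpa using hY₁X 1 (by simpa using this)⟩

/-- The dimension at vertex `1`. -/
def dimV (M : LoopRep K m) : ℤ := Module.finrank K M.V

/-- The dimension at vertex `2`. -/
def dimN (M : LoopRep K m) : ℤ := Module.finrank K M.N

lemma IsSeparated.dimV_translate (hs : M.IsSeparated) (t : Translate M M₁) :
    M₁.dimV = M.dimN - M.dimV := by
  have h₁ := t.q.finrank_range_add_finrank_ker
  have h₂ : LinearMap.ker t.q = LinearMap.range M.j := Submodule.ext t.q_eq_zero_iff
  rw [h₂, LinearMap.finrank_range_of_inj hs.j_injective,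
    LinearMap.range_eq_top.2 t.q_surjective, finrank_top] at h₁
  simp only [dimV, dimN]
  omega

lemma IsSeparated.dimN_translate (hs : M.IsSeparated) (t : Translate M M₁) :
    M₁.dimN = (m + 1) * M₁.dimV - M.dimN := by
  have h₁ := t.π.finrank_range_add_finrank_ker
  have h₂ : LinearMap.ker t.π = LinearMap.range t.ι := Submodule.ext t.π_eq_zero_iff
  rw [h₂, LinearMap.finrank_range_of_inj (hs.ι_injective t),
    LinearMap.range_eq_top.2 t.π_surjective, finrank_top, Cofree.finrank_eq] at h₁
  rw [eq_sub_iff_add_eq]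
  simp only [dimV, dimN]
  exact_mod_cast h₁

/-! #### The two indecomposable projectives -/

section

variable (W : Type) [AddCommGroup W] [Module K W] [FiniteDimensional K W]

lemma free_isRetract : (free K m W).IsRetract :=
  ⟨W, inferInstance, inferInstance, LinearMap.id, LinearMap.id, fun _ => rfl, fun _ => rfl,
    fun _ => rfl⟩

lemma free_isSeparated (hm : 1 ≤ m) : (free K m W).IsSeparated := by
  intro (w : W) (w' : W) h
  have : Cofree.coeff (m - 1) (Cofree.shift (Cofree.gen w : Cofree K m W)) =
    Cofree.coeff (m - 1) (Cofree.gen w') := congrArg _ h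
  rwa [Cofree.coeff_shift, Cofree.coeff_gen, Cofree.coeff_gen, if_pos (by omega),
    if_neg (by omega)] at this

lemma free_extVanish : ExtVanish (free K m W) M' := fun h =>
  ⟨0, Cofree.lift M'.β h, Cofree.lift_shift M'.β_pow h, fun v => by
    rw [LinearMap.zero_apply, map_zero, zero_add]; exact (Cofree.lift_gen _ h v).symm⟩

end

lemma IsRetract.tail (hM : M.IsRetract) : M.tail.IsRetract := hM

lemma tail_isSeparated : M.tail.IsSeparated := fun _ _ _ => rfl

lemma tail_extVanish : ExtVanish M.tail M' := fun h =>
  ⟨0, 0, fun _ => by simp, fun v => by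
    rw [show v = 0 from rfl]; simp⟩

end LoopRep

/-- A nilpotent idempotent endomorphism of `Cofree K m K` vanishes. -/
lemma Cofree.idempotent_eq_zero {K : Type} [Field K] {m : ℕ} {Y : Module.End K (Cofree K m K)}
    (hβ : ∀ f, Y (Cofree.shift f) = Cofree.shift (Y f)) (hY : ∀ f, Y (Y f) = Y f)
    (h0 : Cofree.coeff m (Y (Cofree.gen 1)) = 0) : Y = 0 := by
  have hgen (c : K) (i : ℕ) (hi : m ≤ i) : Cofree.coeff i (Y (Cofree.gen c)) = 0 := by
    rcases hi.eq_or_lt with rfl | hi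
    · rw [← mul_one c, ← smul_eq_mul, map_smul, map_smul, map_smul, h0, smul_zero]
    · exact Cofree.coeff_of_lt _ hi
  have hdrop (f) (k : ℕ) (hf : ∀ i, k ≤ i → Cofree.coeff i f = 0) (i : ℕ) (hi : k ≤ i + 1) :
      Cofree.coeff i (Y f) = 0 := by
    rw [Cofree.eq_sum_gen f, map_sum, map_sum]
    refine Finset.sum_eq_zero fun p hp => ?_
    rw [Cofree.comp_pow hβ, Cofree.coeff_shift_pow]
    rw [Finset.HasAntidiagonal.mem_antidiagonal] at hp
    by_cases h : k ≤ p.1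
    · rw [hf _ h]; simp
    · exact hgen _ _ (by omega)
  have hzero (f) (k : ℕ) (i : ℕ) (hi : m + 1 ≤ i + k) : Cofree.coeff i (Y f) = 0 := by
    induction k generalizing i with
    | zero => exact Cofree.coeff_of_lt _ (by omega)
    | succ k ih =>
      rw [← hY]
      refine hdrop _ (i + 1) (fun i' hi' => ih i' (by omega)) i le_rfl
  ext1 f
  ext i
  exact hzero f (m + 1) i (by omega)

lemma Cofree.idempotent_trivial {K : Type} [Field K] {m : ℕ} {Y : Module.End K (Cofree K m K)}
    (hβ : ∀ f, Y (Cofree.shift f) = Cofree.shift (Y f)) (hY : ∀ f, Y (Y f) = Y f) :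
    Y = 0 ∨ Y = 1 := by
  have hgen (c : K) : (Cofree.gen c : Cofree K m K) = c • Cofree.gen 1 := by
    rw [← map_smul, smul_eq_mul, mul_one]
  have hmul (f) : Cofree.coeff m (Y f) =
      Cofree.coeff m f * Cofree.coeff m (Y (Cofree.gen 1)) := by
    rw [Cofree.eq_sum_gen f, map_sum, map_sum, Finset.sum_eq_single (m, 0)]
    · rw [← Cofree.eq_sum_gen, pow_zero, Module.End.one_apply, hgen, map_smul, map_smul,
        smul_eq_mul]
    · rintro ⟨i, k⟩ hp hne
      rw [Finset.HasAntidiagonal.mem_antidiagonal] at hp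
      have : k ≠ 0 := by
        rintro rfl
        exact hne (by rw [← hp, add_zero])
      rw [Cofree.comp_pow hβ, Cofree.coeff_shift_pow, Cofree.coeff_of_lt _ (by omega)]
    · simp
  have hc := hmul (Y (Cofree.gen 1))
  rw [hY] at hc
  rcases IsIdempotentElem.iff_eq_zero_or_one.1 hc.symm with h | h
  · exact Or.inl (Cofree.idempotent_eq_zero hβ hY h)
  · right
    rw [eq_comm, ← sub_eq_zero]
    refine Cofree.idempotent_eq_zero (fun f => ?_) (fun f => ?_) ?_
    · simp [hβ]
    · simp [hY]
    · simp [h, Cofree.coeff_gen]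

namespace LoopRep

variable {K : Type} [Field K] {m : ℕ}

lemma free_idempotentsTrivial : (free K m K).IdempotentsTrivial := by
  intro (X : Module.End K K) (Y : Module.End K (Cofree K m K)) hβ hj hX _
  have hX' (v : K) : X v = v * X 1 := by rw [← smul_eq_mul, ← map_smul, smul_eq_mul, mul_one]
  have hY (v : K) : Y (Cofree.gen v) = Cofree.gen (X v) := hj v
  have h1 : X 1 * X 1 = X 1 := (hX' _).symm.trans (hX (1 : K))
  have hβ' (f : Cofree K m K) : Y (Cofree.shift f) = Cofree.shift (Y f) := hβ f
  have key (c : K) (hc : X 1 = c) : X = c • 1 ∧ Y = c • 1 := by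
    refine ⟨LinearMap.ext fun v => by simp [hX' v, hc, mul_comm], ?_⟩
    refine Cofree.hom_ext (T := Cofree.shift) hβ' (fun f => (map_smul Cofree.shift c f).symm)
      fun w => ?_
    rw [hY, hX' w, hc, mul_comm, ← smul_eq_mul, map_smul]
    rfl
  rcases IsIdempotentElem.iff_eq_zero_or_one.1 h1 with h | h
  · have := key 0 h
    rw [zero_smul, zero_smul] at this
    exact Or.inl this
  · have := key 1 h
    rw [one_smul, one_smul] at this
    exact Or.inr this

lemma tail_free_idempotentsTrivial : (free K m K).tail.IdempotentsTrivial := by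
  intro X Y hβ _ _ hY
  have hX (X' : Module.End K (free K m K).tail.V) : X = X' := LinearMap.ext fun _ => rfl
  rcases Cofree.idempotent_trivial (Y := Y) hβ hY with h | h
  · exact Or.inl ⟨hX _, h⟩
  · exact Or.inr ⟨hX _, h⟩

end LoopRep

/-! ### Representations as modules over the bound quiver algebra -/

namespace LoopPowerAlgebra

variable {K : Type} [Field K] {m : ℕ}

/-- The action of a generator of the bound quiver algebra on right modules. -/
def act (K : Type) [Field K] (m : ℕ) (g : TPGen (Fin 2)) : (LoopPowerAlgebra K (m + 1))ᵐᵒᵖ :=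
  MulOpposite.op (RingQuot.mkAlgHom K _ (FreeAlgebra.ι K g))

/-- The idempotent at vertex `1`. -/
def e₁ (K : Type) [Field K] (m : ℕ) := act K m (TPGen.v 0)

/-- The idempotent at vertex `2`. -/
def e₂ (K : Type) [Field K] (m : ℕ) := act K m (TPGen.v 1)

/-- The arrow. -/
def arrow (K : Type) [Field K] (m : ℕ) := act K m (TPGen.ar 0)

/-- The loop. -/
def loop (K : Type) [Field K] (m : ℕ) := act K m (TPGen.ar 1)

lemma op_mkAlgHom_eq {x y : FreeAlgebra K (TPGen (Fin 2))}
    (h : QuivRel K (Fin 2) QA.s QA.t {(QA.be K ^ (m + 1), 0)} x y) :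
    (MulOpposite.op (RingQuot.mkAlgHom K _ x) : (LoopPowerAlgebra K (m + 1))ᵐᵒᵖ) =
      MulOpposite.op (RingQuot.mkAlgHom K _ y) :=
  congrArg _ (RingQuot.mkAlgHom_rel K h)

lemma act_mul_act (g g' : TPGen (Fin 2)) : act K m g' * act K m g =
    MulOpposite.op (RingQuot.mkAlgHom K _ (FreeAlgebra.ι K g * FreeAlgebra.ι K g')) := by
  rw [map_mul, MulOpposite.op_mul]
  rfl

lemma e₁_mul_e₁ : e₁ K m * e₁ K m = e₁ K m :=
  (act_mul_act _ _).trans (op_mkAlgHom_eq (QuivRel.idem 0))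

lemma e₂_mul_e₂ : e₂ K m * e₂ K m = e₂ K m :=
  (act_mul_act _ _).trans (op_mkAlgHom_eq (QuivRel.idem 1))

lemma e₁_mul_e₂ : e₁ K m * e₂ K m = 0 :=
  (act_mul_act _ _).trans ((op_mkAlgHom_eq (QuivRel.orth 1 0 (by decide))).trans (by simp))

lemma e₂_mul_e₁ : e₂ K m * e₁ K m = 0 :=
  (act_mul_act _ _).trans ((op_mkAlgHom_eq (QuivRel.orth 0 1 (by decide))).trans (by simp))

lemma e₁_add_e₂ : e₁ K m + e₂ K m = 1 := by
  have := op_mkAlgHom_eq (K := K) (m := m) QuivRel.vsum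
  rw [map_add, map_one] at this
  exact this

lemma arrow_mul_e₁ : arrow K m * e₁ K m = arrow K m :=
  (act_mul_act _ _).trans (op_mkAlgHom_eq (QuivRel.src 0))

lemma e₂_mul_arrow : e₂ K m * arrow K m = arrow K m :=
  (act_mul_act _ _).trans (op_mkAlgHom_eq (QuivRel.tgt 0))

lemma loop_mul_e₂ : loop K m * e₂ K m = loop K m :=
  (act_mul_act _ _).trans (op_mkAlgHom_eq (QuivRel.src 1))

lemma e₂_mul_loop : e₂ K m * loop K m = loop K m :=
  (act_mul_act _ _).trans (op_mkAlgHom_eq (QuivRel.tgt 1))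

lemma loop_pow : loop K m ^ (m + 1) = 0 := by
  have := op_mkAlgHom_eq (K := K) (m := m) (QuivRel.rel (QA.be K ^ (m + 1), 0) rfl)
  rw [map_pow, map_zero, MulOpposite.op_pow] at this
  exact this

lemma arrow_mul_e₂ : arrow K m * e₂ K m = 0 := by
  rw [← arrow_mul_e₁, mul_assoc, e₁_mul_e₂, mul_zero]

lemma loop_mul_e₁ : loop K m * e₁ K m = 0 := by
  rw [← loop_mul_e₂, mul_assoc, e₂_mul_e₁, mul_zero]

/-- A `K`-linear map commuting with the generators is a module homomorphism. -/
lemma map_smul_of_comm {P Q : Type} [AddCommGroup P] [Module K P]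
    [Module (LoopPowerAlgebra K (m + 1))ᵐᵒᵖ P] [IsScalarTower K (LoopPowerAlgebra K (m + 1))ᵐᵒᵖ P]
    [AddCommGroup Q] [Module K Q] [Module (LoopPowerAlgebra K (m + 1))ᵐᵒᵖ Q]
    [IsScalarTower K (LoopPowerAlgebra K (m + 1))ᵐᵒᵖ Q] (f : P →ₗ[K] Q)
    (h₁ : ∀ x, f (e₁ K m • x) = e₁ K m • f x) (h₂ : ∀ x, f (e₂ K m • x) = e₂ K m • f x)
    (hμ : ∀ x, f (arrow K m • x) = arrow K m • f x) (hβ : ∀ x, f (loop K m • x) = loop K m • f x)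
    (r : (LoopPowerAlgebra K (m + 1))ᵐᵒᵖ) (x : P) : f (r • x) = r • f x := by
  induction r using MulOpposite.rec' with | _ r => ?_
  obtain ⟨a, rfl⟩ := RingQuot.mkAlgHom_surjective K _ r
  induction a using FreeAlgebra.induction generalizing x with
  | grade0 c =>
    rw [AlgHom.commutes, ← MulOpposite.algebraMap_apply, algebraMap_smul, algebraMap_smul,
      map_smul]
  | grade1 g =>
    match g with
    | TPGen.v 0 => exact h₁ x
    | TPGen.v 1 => exact h₂ x
    | TPGen.ar 0 => exact hμ x
    | TPGen.ar 1 => exact hβ x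
  | mul a b ha hb => rw [map_mul, MulOpposite.op_mul, mul_smul, mul_smul, hb, ha]
  | add a b ha hb => rw [map_add, MulOpposite.op_add, add_smul, add_smul, map_add, ha, hb]

end LoopPowerAlgebra

namespace LoopRep

open LoopPowerAlgebra

variable {K : Type} [Field K] {m : ℕ} (M : LoopRep K m)

/-- The endomorphism by which a generator acts on the total space of a representation. -/
def genAct : TPGen (Fin 2) → (Module.End K (M.V × M.N))ᵐᵒᵖ
  | TPGen.v 0 => MulOpposite.op (LinearMap.inl K M.V M.N ∘ₗ LinearMap.fst K M.V M.N)
  | TPGen.v 1 => MulOpposite.op (LinearMap.inr K M.V M.N ∘ₗ LinearMap.snd K M.V M.N)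
  | TPGen.ar 0 => MulOpposite.op (LinearMap.inr K M.V M.N ∘ₗ M.j ∘ₗ LinearMap.fst K M.V M.N)
  | TPGen.ar 1 => MulOpposite.op (LinearMap.inr K M.V M.N ∘ₗ M.β ∘ₗ LinearMap.snd K M.V M.N)

lemma inr_comp_pow (T : Module.End K M.N) (k : ℕ) :
    (LinearMap.inr K M.V M.N ∘ₗ T ∘ₗ LinearMap.snd K M.V M.N : Module.End K (M.V × M.N)) ^ (k + 1)
      = LinearMap.inr K M.V M.N ∘ₗ (T ^ (k + 1)) ∘ₗ LinearMap.snd K M.V M.N := by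
  induction k with
  | zero => simp
  | succ k ih => rw [pow_succ, ih, pow_succ T (k + 1)]; rfl

/-- The action of the bound quiver algebra on the total space of a representation. -/
def actHom : LoopPowerAlgebra K (m + 1) →ₐ[K] (Module.End K (M.V × M.N))ᵐᵒᵖ :=
  RingQuot.liftAlgHom K ⟨FreeAlgebra.lift K M.genAct, by
    intro x y h
    induction h with
    | idem i => fin_cases i <;> simp [vtx, genAct, ← MulOpposite.op_mul] <;> rfl
    | orth i j hij =>
      fin_cases i <;> fin_cases j <;> simp_all [vtx, genAct, ← MulOpposite.op_mul] <;> ext <;> simp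
    | vsum => simp [vtx, genAct, ← MulOpposite.op_add]; ext <;> simp
    | src a => fin_cases a <;> simp [vtx, arr, QA.s, genAct, ← MulOpposite.op_mul] <;> rfl
    | tgt a => fin_cases a <;> simp [vtx, arr, QA.t, genAct, ← MulOpposite.op_mul] <;> rfl
    | rel p hp =>
      obtain rfl := hp
      simp [QA.be, arr, genAct, ← MulOpposite.op_pow, inr_comp_pow, M.β_pow]⟩

/-- The total space of a representation. -/
def U : Type := M.V × M.N

instance : AddCommGroup M.U := inferInstanceAs (AddCommGroup (M.V × M.N))

instance : Module K M.U := inferInstanceAs (Module K (M.V × M.N))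

instance : FiniteDimensional K M.U := inferInstanceAs (FiniteDimensional K (M.V × M.N))

/-- The right module structure on the total space of a representation. -/
instance : Module (LoopPowerAlgebra K (m + 1))ᵐᵒᵖ M.U :=
  Module.compHom (M.V × M.N) (AlgHom.opComm M.actHom).toRingHom

lemma smul_def (r : (LoopPowerAlgebra K (m + 1))ᵐᵒᵖ) (x : M.U) :
    r • x = (AlgHom.opComm M.actHom r : Module.End K (M.V × M.N)) x := rfl

instance : IsScalarTower K (LoopPowerAlgebra K (m + 1))ᵐᵒᵖ M.U where
  smul_assoc c r x := by rw [smul_def, smul_def, map_smul]; rfl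

lemma act_smul (g : TPGen (Fin 2)) (x : M.U) :
    act K m g • x = (MulOpposite.unop (M.genAct g) : Module.End K (M.V × M.N)) x := by
  rw [smul_def]
  simp [act, actHom, AlgHom.opComm]
  rfl

/-- The inclusion of the space at vertex `1`. -/
def inV : M.V →ₗ[K] M.U := LinearMap.inl K M.V M.N

/-- The inclusion of the space at vertex `2`. -/
def inN : M.N →ₗ[K] M.U := LinearMap.inr K M.V M.N

/-- The projection onto the space at vertex `1`. -/
def fstU : M.U →ₗ[K] M.V := LinearMap.fst K M.V M.N

/-- The projection onto the space at vertex `2`. -/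
def sndU : M.U →ₗ[K] M.N := LinearMap.snd K M.V M.N

lemma e₁_smul (x : M.U) : e₁ K m • x = M.inV (M.fstU x) := M.act_smul _ _

lemma e₂_smul (x : M.U) : e₂ K m • x = M.inN (M.sndU x) := M.act_smul _ _

lemma arrow_smul (x : M.U) : arrow K m • x = M.inN (M.j (M.fstU x)) := M.act_smul _ _

lemma loop_smul (x : M.U) : loop K m • x = M.inN (M.β (M.sndU x)) := M.act_smul _ _

end LoopRep

namespace LoopRep

open LoopPowerAlgebra

variable {K : Type} [Field K] {m : ℕ} {M M' M₁ M₁' : LoopRep K m}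

lemma U_ext {x y : M.U} (h₁ : M.fstU x = M.fstU y) (h₂ : M.sndU x = M.sndU y) : x = y :=
  Prod.ext h₁ h₂

@[simp] lemma fstU_inV (v : M.V) : M.fstU (M.inV v) = v := rfl

@[simp] lemma fstU_inN (n : M.N) : M.fstU (M.inN n) = 0 := rfl

@[simp] lemma sndU_inV (v : M.V) : M.sndU (M.inV v) = 0 := rfl

@[simp] lemma sndU_inN (n : M.N) : M.sndU (M.inN n) = n := rfl

lemma inV_add_inN (x : M.U) : M.inV (M.fstU x) + M.inN (M.sndU x) = x :=
  U_ext (by simp) (by simp)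

section Hom

variable {Q : Type} [AddCommGroup Q] [Module K Q] [Module (LoopPowerAlgebra K (m + 1))ᵐᵒᵖ Q]
  [IsScalarTower K (LoopPowerAlgebra K (m + 1))ᵐᵒᵖ Q]

/-- The module homomorphism given by its components at the two vertices. -/
def homOf (X : M.V →ₗ[K] Q) (Y : M.N →ₗ[K] Q) (hX : ∀ v, e₁ K m • X v = X v)
    (hY : ∀ n, e₂ K m • Y n = Y n) (hβ : ∀ n, Y (M.β n) = loop K m • Y n)
    (hj : ∀ v, arrow K m • X v = Y (M.j v)) : M.U →ₗ[(LoopPowerAlgebra K (m + 1))ᵐᵒᵖ] Q where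
  toFun x := (X ∘ₗ M.fstU + Y ∘ₗ M.sndU) x
  map_add' := map_add _
  map_smul' := by
    refine map_smul_of_comm _ (fun x => ?_) (fun x => ?_) (fun x => ?_) (fun x => ?_) <;>
      simp only [LinearMap.add_apply, LinearMap.comp_apply, smul_add]
    · rw [hX, ← hY (M.sndU x), smul_smul, e₁_mul_e₂, zero_smul, e₁_smul]
      simp
    · rw [hY, ← hX (M.fstU x), smul_smul, e₂_mul_e₁, zero_smul, e₂_smul]
      simp
    · rw [hj, ← hY (M.sndU x), smul_smul, arrow_mul_e₂, zero_smul, arrow_smul]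
      simp
    · rw [← hβ, ← hX (M.fstU x), smul_smul, loop_mul_e₁, zero_smul, loop_smul]
      simp

lemma homOf_apply {X : M.V →ₗ[K] Q} {Y : M.N →ₗ[K] Q} (hX hY hβ hj) (x : M.U) :
    homOf X Y hX hY hβ hj x = X (M.fstU x) + Y (M.sndU x) := rfl

/-- The action of an element of the algebra as a linear map. -/
def smulEnd (Q : Type) [AddCommGroup Q] [Module K Q] [Module (LoopPowerAlgebra K (m + 1))ᵐᵒᵖ Q]
    [IsScalarTower K (LoopPowerAlgebra K (m + 1))ᵐᵒᵖ Q]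
    (r : (LoopPowerAlgebra K (m + 1))ᵐᵒᵖ) : Module.End K Q :=
  Module.toModuleEnd K _ r

lemma smulEnd_apply (r : (LoopPowerAlgebra K (m + 1))ᵐᵒᵖ) (x : Q) :
    smulEnd (K := K) Q r x = r • x := rfl

lemma smulEnd_loop_pow : smulEnd (K := K) Q (loop K m) ^ (m + 1) = 0 := by
  unfold smulEnd
  rw [← map_pow, loop_pow, map_zero]

variable {W : Type} [AddCommGroup W] [Module K W]

/-- The extension of a linear map to the free representation of the loop. -/
def loopLift (s : W →ₗ[K] Q) : Cofree K m W →ₗ[K] Q :=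
  Cofree.lift (smulEnd Q (loop K m)) s

lemma loopLift_shift (s : W →ₗ[K] Q) (f : Cofree K m W) :
    loopLift s (Cofree.shift f) = loop K m • loopLift s f :=
  Cofree.lift_shift smulEnd_loop_pow s f

lemma loopLift_gen (s : W →ₗ[K] Q) (w : W) :
    loopLift s (Cofree.gen w : Cofree K m W) = s w :=
  Cofree.lift_gen _ s w

lemma e₂_smul_loopLift {s : W →ₗ[K] Q} (hs : ∀ w, e₂ K m • s w = s w) (f : Cofree K m W) :
    e₂ K m • loopLift s f = loopLift s f := by
  refine LinearMap.congr_fun (f := smulEnd Q (e₂ K m) ∘ₗ loopLift s) (Cofree.hom_ext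
    (T := smulEnd Q (loop K m)) (fun f => ?_) (loopLift_shift s) fun w => ?_) f
  · simp only [LinearMap.comp_apply, smulEnd_apply, loopLift_shift, smul_smul]
    rw [e₂_mul_loop, loop_mul_e₂]
  · rw [LinearMap.comp_apply, loopLift_gen, smulEnd_apply, hs]

lemma map_loopLift {Q' : Type} [AddCommGroup Q'] [Module K Q']
    [Module (LoopPowerAlgebra K (m + 1))ᵐᵒᵖ Q'] [IsScalarTower K (LoopPowerAlgebra K (m + 1))ᵐᵒᵖ Q']
    (f : Q →ₗ[(LoopPowerAlgebra K (m + 1))ᵐᵒᵖ] Q') {s : W →ₗ[K] Q} {g : Cofree K m W →ₗ[K] Q'}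
    (hg : ∀ x, g (Cofree.shift x) = loop K m • g x) (hs : ∀ w, f (s w) = g (Cofree.gen w))
    (x : Cofree K m W) : f (loopLift s x) = g x := by
  refine LinearMap.congr_fun (f := f.restrictScalars K ∘ₗ loopLift s) (Cofree.hom_ext
    (T := smulEnd Q' (loop K m)) (fun x => ?_) hg fun w => ?_) x
  · simp [loopLift_shift, smulEnd_apply]
  · simp [loopLift_gen, hs]

variable [FiniteDimensional K W]

/-- The homomorphism from a free representation determined by the images of the generators. -/
def freeHom (s : W →ₗ[K] Q) (hs : ∀ w, e₁ K m • s w = s w) :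
    (free K m W).U →ₗ[(LoopPowerAlgebra K (m + 1))ᵐᵒᵖ] Q :=
  homOf (M := free K m W) s (loopLift (smulEnd Q (arrow K m) ∘ₗ s)) hs
    (e₂_smul_loopLift fun w => by
      rw [LinearMap.comp_apply, smulEnd_apply, smul_smul, e₂_mul_arrow])
    (loopLift_shift _) fun w => (loopLift_gen (smulEnd Q (arrow K m) ∘ₗ s) w).symm

/-- The homomorphism from the tail of a free representation determined by the images of the
generators. -/
def tailFreeHom (s : W →ₗ[K] Q) (hs : ∀ w, e₂ K m • s w = s w) :
    (free K m W).tail.U →ₗ[(LoopPowerAlgebra K (m + 1))ᵐᵒᵖ] Q :=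
  homOf (M := (free K m W).tail) 0 (loopLift s) (by simp) (e₂_smul_loopLift hs) (loopLift_shift s)
    (fun v => (smul_zero _).trans (map_zero (loopLift s)).symm)

lemma map_homOf {Q' : Type} [AddCommGroup Q'] [Module K Q']
    [Module (LoopPowerAlgebra K (m + 1))ᵐᵒᵖ Q'] [IsScalarTower K (LoopPowerAlgebra K (m + 1))ᵐᵒᵖ Q']
    (f : Q →ₗ[(LoopPowerAlgebra K (m + 1))ᵐᵒᵖ] Q') (g : M.U →ₗ[(LoopPowerAlgebra K (m + 1))ᵐᵒᵖ] Q')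
    {X : M.V →ₗ[K] Q} {Y : M.N →ₗ[K] Q} (hX hY hβ hj)
    (h₁ : ∀ v, f (X v) = g (M.inV v)) (h₂ : ∀ n, f (Y n) = g (M.inN n)) :
    f ∘ₗ homOf X Y hX hY hβ hj = g := by
  ext x
  rw [LinearMap.comp_apply, homOf_apply, map_add, h₁, h₂, ← map_add, inV_add_inN]

end Hom

instance : Module.Finite (LoopPowerAlgebra K (m + 1))ᵐᵒᵖ M.U :=
  Module.Finite.of_restrictScalars_finite K _ _

/-- The module homomorphism induced by a morphism of representations. -/
def homU (X : M.V →ₗ[K] M'.V) (Y : M.N →ₗ[K] M'.N) (hβ : ∀ n, Y (M.β n) = M'.β (Y n))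
    (hj : ∀ v, Y (M.j v) = M'.j (X v)) : M.U →ₗ[(LoopPowerAlgebra K (m + 1))ᵐᵒᵖ] M'.U :=
  homOf (M'.inV ∘ₗ X) (M'.inN ∘ₗ Y) (fun v => by simp [e₁_smul]) (fun n => by simp [e₂_smul])
    (fun n => by simp [loop_smul, hβ]) (fun v => by simp [arrow_smul, hj])

@[simp] lemma fstU_homU {X : M.V →ₗ[K] M'.V} {Y : M.N →ₗ[K] M'.N} (hβ hj) (x : M.U) :
    M'.fstU (homU X Y hβ hj x) = X (M.fstU x) := by simp [homU, homOf_apply]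

@[simp] lemma sndU_homU {X : M.V →ₗ[K] M'.V} {Y : M.N →ₗ[K] M'.N} (hβ hj) (x : M.U) :
    M'.sndU (homU X Y hβ hj x) = Y (M.sndU x) := by simp [homU, homOf_apply]

lemma exists_homU_eq (f : M.U →ₗ[(LoopPowerAlgebra K (m + 1))ᵐᵒᵖ] M'.U) :
    ∃ (X : M.V →ₗ[K] M'.V) (Y : M.N →ₗ[K] M'.N) (hβ : ∀ n, Y (M.β n) = M'.β (Y n))
      (hj : ∀ v, Y (M.j v) = M'.j (X v)), f = homU X Y hβ hj := by
  refine ⟨M'.fstU ∘ₗ f.restrictScalars K ∘ₗ M.inV, M'.sndU ∘ₗ f.restrictScalars K ∘ₗ M.inN,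
    fun n => ?_, fun v => ?_, LinearMap.ext fun x => U_ext ?_ ?_⟩
  · have : M.inN (M.β n) = loop K m • M.inN n := by simp [loop_smul]
    simp only [LinearMap.comp_apply, LinearMap.restrictScalars_apply]
    rw [this, map_smul, loop_smul, sndU_inN]
  · have : M.inN (M.j v) = arrow K m • M.inV v := by simp [arrow_smul]
    simp only [LinearMap.comp_apply, LinearMap.restrictScalars_apply]
    rw [this, map_smul, arrow_smul, sndU_inN]
  · rw [fstU_homU, LinearMap.comp_apply, LinearMap.comp_apply, LinearMap.restrictScalars_apply,
      ← e₁_smul, map_smul, e₁_smul, fstU_inV]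
  · rw [sndU_homU, LinearMap.comp_apply, LinearMap.comp_apply, LinearMap.restrictScalars_apply,
      ← e₂_smul, map_smul, e₂_smul, sndU_inN]

lemma IdempotentsTrivial.isIndecModule (hM : M.IdempotentsTrivial) (hU : Nontrivial M.U) :
    IsIndecModule (LoopPowerAlgebra K (m + 1))ᵐᵒᵖ M.U := by
  refine ⟨hU, fun N₁ N₂ h => ?_⟩
  let p := N₁.projection N₂ h
  have hp (x) : p (p x) = p x :=
    Submodule.projection_apply_of_mem_left h (Submodule.projection_apply_mem h x)
  obtain ⟨X, Y, hβ, hj, hXY⟩ := exists_homU_eq p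
  have hX (v) : X (X v) = X v := by
    simpa [hXY] using congrArg M.fstU (hp (M.inV v))
  have hY (v) : Y (Y v) = Y v := by
    simpa [hXY] using congrArg M.sndU (hp (M.inN v))
  rcases hM X Y hβ hj hX hY with ⟨rfl, rfl⟩ | ⟨rfl, rfl⟩
  · left
    rw [← Submodule.range_projection h, LinearMap.range_eq_bot]
    change p = 0
    rw [hXY]
    exact LinearMap.ext fun x => U_ext (by simp) (by simp)
  · right
    rw [← Submodule.ker_projection h, LinearMap.ker_eq_bot']
    intro x hx
    change p x = 0 at hx
    rw [hXY] at hx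
    exact U_ext (by simpa using congrArg M.fstU hx) (by simpa using congrArg M.sndU hx)

lemma finrank_U : (Module.finrank K M.U : ℤ) = M.dimV + M.dimN := by
  have h : Module.finrank K M.U = Module.finrank K M.V + Module.finrank K M.N :=
    Module.finrank_prod
  simp only [h, dimV, dimN, Nat.cast_add]

lemma dim_eq_of_equiv (e : M.U ≃ₗ[(LoopPowerAlgebra K (m + 1))ᵐᵒᵖ] M'.U) :
    M.dimV + M.dimN = M'.dimV + M'.dimN := by
  rw [← finrank_U, ← finrank_U, (e.restrictScalars K).finrank_eq]

lemma projective_of_split {P : Type} [AddCommGroup P] [Module (LoopPowerAlgebra K (m + 1))ᵐᵒᵖ P]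
    (h : ∀ (Q : Type) [AddCommGroup Q] [Module K Q] [Module (LoopPowerAlgebra K (m + 1))ᵐᵒᵖ Q]
      [IsScalarTower K (LoopPowerAlgebra K (m + 1))ᵐᵒᵖ Q]
      (f : Q →ₗ[(LoopPowerAlgebra K (m + 1))ᵐᵒᵖ] P), Function.Surjective f →
      ∃ g : P →ₗ[(LoopPowerAlgebra K (m + 1))ᵐᵒᵖ] Q, f ∘ₗ g = LinearMap.id) :
    Module.Projective (LoopPowerAlgebra K (m + 1))ᵐᵒᵖ P :=
  Module.Projective.of_lifting_property'' fun f hf =>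
    h (P →₀ (LoopPowerAlgebra K (m + 1))ᵐᵒᵖ) f hf

lemma projective_free (W : Type) [AddCommGroup W] [Module K W] [FiniteDimensional K W] :
    Module.Projective (LoopPowerAlgebra K (m + 1))ᵐᵒᵖ (free K m W).U := by
  refine projective_of_split fun Q _ _ _ _ f hf => ?_
  obtain ⟨σ, hσ⟩ := LinearMap.exists_rightInverse_of_surjective (f.restrictScalars K)
    (LinearMap.range_eq_top.2 hf)
  have hσ (x) : f (σ x) = x := LinearMap.congr_fun hσ x
  let iV : W →ₗ[K] (free K m W).U := (free K m W).inV
  have h₁ (w : W) : e₁ K m • iV w = iV w := e₁_smul _ _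
  refine ⟨freeHom (smulEnd Q (e₁ K m) ∘ₗ σ ∘ₗ iV) fun w => ?_,
    map_homOf f LinearMap.id _ _ _ _ (fun w => ?_) fun n => ?_⟩
  · simp [smulEnd_apply, smul_smul, e₁_mul_e₁]
  · change f (e₁ K m • σ (iV w)) = iV w
    rw [map_smul, hσ]
    exact h₁ w
  · refine map_loopLift f (g := (free K m W).inN)
      (fun x => ((free K m W).loop_smul ((free K m W).inN x)).symm) (fun w => ?_) n
    change f (arrow K m • e₁ K m • σ (iV w)) = (free K m W).inN (Cofree.gen w)
    rw [map_smul, map_smul, hσ, h₁]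
    exact arrow_smul _ _

lemma IsRetract.projective_tail (hM : M.IsRetract) :
    Module.Projective (LoopPowerAlgebra K (m + 1))ᵐᵒᵖ M.tail.U := by
  obtain ⟨W, _, _, i, r, hi, hr, hri⟩ := hM.tail
  refine projective_of_split fun Q _ _ _ _ f hf => ?_
  obtain ⟨σ, hσ⟩ := LinearMap.exists_rightInverse_of_surjective (f.restrictScalars K)
    (LinearMap.range_eq_top.2 hf)
  have hσ (x) : f (σ x) = x := LinearMap.congr_fun hσ x
  let s : W →ₗ[K] Q := smulEnd Q (e₂ K m) ∘ₗ σ ∘ₗ M.tail.inN ∘ₗ r ∘ₗ Cofree.gen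
  have hs (w) : e₂ K m • s w = s w := by simp [s, smulEnd_apply, smul_smul, e₂_mul_e₂]
  refine ⟨homOf (M := M.tail) 0 (loopLift s ∘ₗ i) (by simp) (fun n => e₂_smul_loopLift hs (i n))
    (fun n => ?_) (fun v => (smul_zero _).trans (map_zero (loopLift s ∘ₗ i)).symm),
    map_homOf f LinearMap.id _ _ _ _ (fun w => ?_) fun n => ?_⟩
  · rw [LinearMap.comp_apply, LinearMap.comp_apply, ← loopLift_shift, ← hi]
  · rw [LinearMap.zero_apply, map_zero, show w = 0 from rfl, map_zero, map_zero]
  · refine (map_loopLift f (g := M.tail.inN ∘ₗ r) (fun x => ?_) (fun w => ?_) _).trans ?_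
    · rw [LinearMap.comp_apply, LinearMap.comp_apply, hr, loop_smul, sndU_inN]
    · change f (e₂ K m • σ (M.tail.inN (r (Cofree.gen w)))) = M.tail.inN (r (Cofree.gen w))
      rw [map_smul, hσ, e₂_smul, sndU_inN]
    · exact congrArg M.tail.inN (hri n)

variable (K m) in
/-- The algebra is the sum of its two indecomposable projectives. -/
lemma exists_regular_equiv : Nonempty
    (((free K m K).U × (free K m K).tail.U) ≃ₗ[(LoopPowerAlgebra K (m + 1))ᵐᵒᵖ]
      (LoopPowerAlgebra K (m + 1))ᵐᵒᵖ) := by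
  let F := freeHom (m := m) (LinearMap.toSpanSingleton K _ (e₁ K m))
    (fun c => by simp [e₁_mul_e₁])
  let G := tailFreeHom (m := m) (LinearMap.toSpanSingleton K _ (e₂ K m))
    (fun c => by simp [e₂_mul_e₂])
  let x : (free K m K).U := (free K m K).inV (1 : K)
  let y : (free K m K).tail.U := (free K m K).tail.inN (Cofree.gen (1 : K))
  have h₁x : e₁ K m • x = x := e₁_smul _ _
  have h₂x : e₂ K m • x = 0 := (e₂_smul _ _).trans (map_zero _)
  have h₁y : e₁ K m • y = 0 := (e₁_smul _ _).trans (map_zero _)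
  have h₂y : e₂ K m • y = y := e₂_smul _ _
  have he₁ : e₁ K m • (x, y) = (x, 0) := by rw [Prod.smul_mk, h₁x, h₁y]
  have he₂ : e₂ K m • (x, y) = (0, y) := by rw [Prod.smul_mk, h₂x, h₂y]
  have hx (c : K) : c • x = (free K m K).inV c :=
    (map_smul (free K m K).inV c (1 : K)).symm.trans (congrArg _ (mul_one c))
  have hy (c : K) : c • y = (free K m K).tail.inN (Cofree.gen c) := by
    refine (map_smul (free K m K).tail.inN c _).symm.trans (congrArg _ ?_)
    exact (map_smul Cofree.gen c (1 : K)).symm.trans (congrArg _ (mul_one c))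
  have hΦF : LinearMap.toSpanSingleton (LoopPowerAlgebra K (m + 1))ᵐᵒᵖ _ (x, y) ∘ₗ F =
      LinearMap.inl _ _ _ := by
    refine map_homOf _ _ _ _ _ _ (fun (c : K) => ?_) fun n => ?_
    · change (c • e₁ K m) • (x, y) = ((free K m K).inV c, 0)
      rw [smul_assoc, he₁, Prod.smul_mk, smul_zero, hx]
    · refine map_loopLift _ (Q' := (free K m K).U × (free K m K).tail.U)
        (g := LinearMap.inl K _ _ ∘ₗ (free K m K).inN) (fun d => ?_)
        (fun (c : K) => ?_) n
      · exact Prod.ext ((free K m K).loop_smul ((free K m K).inN d)).symm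
          (smul_zero (loop K m)).symm
      · change (arrow K m • c • e₁ K m) • (x, y) = ((free K m K).inN (Cofree.gen c), 0)
        have h₀ : c • (x, (0 : (free K m K).tail.U)) = ((free K m K).inV c, 0) :=
          Prod.ext (hx c) (smul_zero c)
        rw [smul_assoc, smul_assoc, he₁, h₀]
        exact Prod.ext ((free K m K).arrow_smul ((free K m K).inV c)) (smul_zero _)
  have hΦG : LinearMap.toSpanSingleton (LoopPowerAlgebra K (m + 1))ᵐᵒᵖ _ (x, y) ∘ₗ G =
      LinearMap.inr _ _ _ := by
    refine map_homOf _ _ _ _ _ _ (fun c => ?_) fun n => ?_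
    · rw [LinearMap.zero_apply, map_zero, show c = 0 from rfl, map_zero, map_zero]
    · refine map_loopLift _ (Q' := (free K m K).U × (free K m K).tail.U)
        (g := LinearMap.inr K _ _ ∘ₗ (free K m K).tail.inN) (fun d => ?_)
        (fun (c : K) => ?_) n
      · exact Prod.ext (smul_zero (loop K m)).symm
          ((free K m K).tail.loop_smul ((free K m K).tail.inN d)).symm
      · change (c • e₂ K m) • (x, y) = (0, (free K m K).tail.inN (Cofree.gen c))
        rw [smul_assoc, he₂, Prod.smul_mk, smul_zero, hy]
  refine ⟨LinearEquiv.ofLinearMap (F.coprod G)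
    (LinearMap.toSpanSingleton (LoopPowerAlgebra K (m + 1))ᵐᵒᵖ _ (x, y)) ?_ ?_⟩
  · ext
    change F ((1 : (LoopPowerAlgebra K (m + 1))ᵐᵒᵖ) • x) +
      G ((1 : (LoopPowerAlgebra K (m + 1))ᵐᵒᵖ) • y) = 1
    rw [one_smul, one_smul, ← e₁_add_e₂]
    congr 1
    · change (1 : K) • e₁ K m + loopLift _ 0 = _
      rw [map_zero, one_smul, add_zero]
    · change 0 + loopLift (LinearMap.toSpanSingleton K (LoopPowerAlgebra K (m + 1))ᵐᵒᵖ (e₂ K m))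
        (Cofree.gen (1 : K) : Cofree K m K) = e₂ K m
      rw [loopLift_gen, zero_add, LinearMap.toSpanSingleton_apply, one_smul]
  · rw [LinearMap.comp_coprod, hΦF, hΦG, LinearMap.coprod_inl_inr]

end LoopRep

/-! ### Direct sums of two modules -/

section

variable {R : Type} [Ring R]

section

variable {A B M : Type} [AddCommGroup A] [Module R A] [AddCommGroup B] [Module R B]
  [AddCommGroup M] [Module R M]

lemma IsIndecModule.of_equiv (h : IsIndecModule R A) (e : A ≃ₗ[R] B) : IsIndecModule R B := by
  have := h.1
  refine ⟨e.symm.toEquiv.nontrivial, fun N₁ N₂ hN => ?_⟩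
  let o := (Submodule.orderIsoMapComap e).symm
  rcases h.2 _ _ (o.isCompl hN) with h | h
  · exact Or.inl ((map_eq_bot_iff o).1 h)
  · exact Or.inr ((map_eq_bot_iff o).1 h)

lemma exists_isInternal_pair (e : (A × B) ≃ₗ[R] M) (hA : IsIndecModule R A)
    (hB : IsIndecModule R B) (hAB : IsEmpty (A ≃ₗ[R] B)) :
    ∃ N : Fin 2 → Submodule R M, DirectSum.IsInternal N ∧ (∀ i, IsIndecModule R (N i)) ∧
      ∀ i j, i ≠ j → IsEmpty (N i ≃ₗ[R] N j) := by
  have hl : Function.Injective (e.toLinearMap ∘ₗ LinearMap.inl R A B) :=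
    e.injective.comp LinearMap.inl_injective
  have hr : Function.Injective (e.toLinearMap ∘ₗ LinearMap.inr R A B) :=
    e.injective.comp LinearMap.inr_injective
  let N : Fin 2 → Submodule R M := ![LinearMap.range (e.toLinearMap ∘ₗ LinearMap.inl R A B),
    LinearMap.range (e.toLinearMap ∘ₗ LinearMap.inr R A B)]
  let eA : A ≃ₗ[R] N 0 := LinearEquiv.ofInjective _ hl
  let eB : B ≃ₗ[R] N 1 := LinearEquiv.ofInjective _ hr
  refine ⟨N, (DirectSum.isInternal_submodule_iff_isCompl N (i := 0) (j := 1) (by decide)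
    (by ext i; fin_cases i <;> simp)).2 ?_, Fin.forall_fin_two.2 ⟨hA.of_equiv eA, hB.of_equiv eB⟩,
    Fin.forall_fin_two.2 ⟨Fin.forall_fin_two.2 ⟨fun h => (h rfl).elim, fun _ => ⟨fun f =>
      hAB.false ((eA.trans f).trans eB.symm)⟩⟩, Fin.forall_fin_two.2 ⟨fun _ => ⟨fun f =>
      hAB.false ((eA.trans f.symm).trans eB.symm)⟩, fun h => (h rfl).elim⟩⟩⟩
  change IsCompl (LinearMap.range (e.toLinearMap ∘ₗ LinearMap.inl R A B))
    (LinearMap.range (e.toLinearMap ∘ₗ LinearMap.inr R A B))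
  rw [LinearMap.range_comp, LinearMap.range_comp]
  exact (Submodule.orderIsoMapComap e).isCompl LinearMap.isCompl_range_inl_inr

lemma isBasicModuleCat_of_equiv_prod (e : (A × B) ≃ₗ[R] M) (hA : IsIndecModule R A)
    (hB : IsIndecModule R B) (hAB : IsEmpty (A ≃ₗ[R] B)) :
    IsBasicModuleCat R (ModuleCat.of R M) :=
  ⟨2, exists_isInternal_pair e hA hB hAB⟩

lemma hasIndecClassCount_of_equiv_prod (e : (A × B) ≃ₗ[R] M) (hA : IsIndecModule R A)
    (hB : IsIndecModule R B) (hAB : IsEmpty (A ≃ₗ[R] B)) :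
    HasIndecClassCount R (ModuleCat.of R M) 2 := by
  obtain ⟨N, hN, hi, hne⟩ := exists_isInternal_pair e hA hB hAB
  refine ⟨2, N, hN, hi, id, Function.surjective_id, fun i j => ⟨?_, fun ⟨f⟩ => ?_⟩⟩
  · rintro rfl
    exact ⟨LinearEquiv.refl R _⟩
  · by_contra h
    exact (hne i j h).false f

lemma hasIndecClassCount_of_subsingleton [Subsingleton M] :
    HasIndecClassCount R (ModuleCat.of R M) 0 := by
  refine ⟨0, Fin.elim0, ?_, fun i => i.elim0, id, Function.surjective_id, fun i => i.elim0⟩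
  exact ⟨Function.injective_of_subsingleton _, fun x => ⟨0, Subsingleton.elim _ _⟩⟩

end

/-- The τ-rigidity of a direct sum, from presentations of the two summands. -/
lemma isTauRigidCat_prod {P₁ P₀ A Q₁ Q₀ B : Type} [AddCommGroup P₁] [Module R P₁]
    [AddCommGroup P₀] [Module R P₀] [AddCommGroup A] [Module R A] [AddCommGroup Q₁] [Module R Q₁]
    [AddCommGroup Q₀] [Module R Q₀] [AddCommGroup B] [Module R B]
    [Module.Finite R P₁] [Module.Projective R P₁] [Module.Finite R P₀] [Module.Projective R P₀]
    [Module.Finite R Q₁] [Module.Projective R Q₁] [Module.Finite R Q₀] [Module.Projective R Q₀]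
    [Module.Finite R A] [Module.Finite R B]
    (f : P₁ →ₗ[R] P₀) (g : P₀ →ₗ[R] A) (f' : Q₁ →ₗ[R] Q₀) (g' : Q₀ →ₗ[R] B)
    (hg : Function.Surjective g) (hg' : Function.Surjective g')
    (hfg : LinearMap.range f = LinearMap.ker g) (hfg' : LinearMap.range f' = LinearMap.ker g')
    (hPA : ∀ h : P₁ →ₗ[R] A, ∃ h' : P₀ →ₗ[R] A, h = h' ∘ₗ f)
    (hPB : ∀ h : P₁ →ₗ[R] B, ∃ h' : P₀ →ₗ[R] B, h = h' ∘ₗ f)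
    (hQA : ∀ h : Q₁ →ₗ[R] A, ∃ h' : Q₀ →ₗ[R] A, h = h' ∘ₗ f')
    (hQB : ∀ h : Q₁ →ₗ[R] B, ∃ h' : Q₀ →ₗ[R] B, h = h' ∘ₗ f') :
    IsTauRigidCat R (ModuleCat.of R (A × B)) := by
  refine ⟨inferInstanceAs (Module.Finite R (A × B)), ModuleCat.of R (P₁ × Q₁),
    ModuleCat.of R (P₀ × Q₀), f.prodMap f', g.prodMap g',
    inferInstanceAs (Module.Finite R (P₁ × Q₁)), inferInstanceAs (Module.Projective R (P₁ × Q₁)),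
    inferInstanceAs (Module.Finite R (P₀ × Q₀)), inferInstanceAs (Module.Projective R (P₀ × Q₀)),
    hg.prodMap hg', ?_, fun (h : P₁ × Q₁ →ₗ[R] A × B) => ?_⟩
  · change LinearMap.range (f.prodMap f') = LinearMap.ker (g.prodMap g')
    rw [LinearMap.range_prodMap, LinearMap.ker_prodMap, hfg, hfg']
  · obtain ⟨a, ha⟩ := hPA (LinearMap.fst R A B ∘ₗ h ∘ₗ LinearMap.inl R P₁ Q₁)
    obtain ⟨b, hb⟩ := hPB (LinearMap.snd R A B ∘ₗ h ∘ₗ LinearMap.inl R P₁ Q₁)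
    obtain ⟨c, hc⟩ := hQA (LinearMap.fst R A B ∘ₗ h ∘ₗ LinearMap.inr R P₁ Q₁)
    obtain ⟨d, hd⟩ := hQB (LinearMap.snd R A B ∘ₗ h ∘ₗ LinearMap.inr R P₁ Q₁)
    refine ⟨((a.prod b).coprod (c.prod d) : P₀ × Q₀ →ₗ[R] A × B), ?_⟩
    change h = ((a.prod b).coprod (c.prod d)) ∘ₗ f.prodMap f'
    refine LinearMap.prod_ext (LinearMap.ext fun x => Prod.ext ?_ ?_)
      (LinearMap.ext fun x => Prod.ext ?_ ?_)
    · simpa using LinearMap.congr_fun ha x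
    · simpa using LinearMap.congr_fun hb x
    · simpa using LinearMap.congr_fun hc x
    · simpa using LinearMap.congr_fun hd x

end

/-! ### An infinite family of support τ-tilting modules -/

namespace LoopRep

variable {K : Type} [Field K] {m : ℕ} {M M' M₁ M₁' : LoopRep K m}

namespace Translate

/-- The first map of the projective presentation of the translate. -/
def relU (t : Translate M M₁) :
    M.tail.U →ₗ[(LoopPowerAlgebra K (m + 1))ᵐᵒᵖ] (free K m M₁.V).U :=
  homU (M := M.tail) (M' := free K m M₁.V) 0 t.ι t.ι_β fun _ =>
    (map_zero t.ι).trans (map_zero Cofree.gen).symm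

/-- The projective cover of the translate. -/
def coverU (t : Translate M M₁) :
    (free K m M₁.V).U →ₗ[(LoopPowerAlgebra K (m + 1))ᵐᵒᵖ] M₁.U :=
  homU (M := free K m M₁.V) LinearMap.id t.π t.π_shift t.π_gen

lemma fstU_relU (t : Translate M M₁) (x : M.tail.U) :
    (free K m M₁.V).fstU (t.relU x) = (0 : M₁.V) := fstU_homU _ _ x

lemma sndU_relU (t : Translate M M₁) (x : M.tail.U) :
    (free K m M₁.V).sndU (t.relU x) = t.ι (M.tail.sndU x) := sndU_homU _ _ x

lemma fstU_coverU (t : Translate M M₁) (x : (free K m M₁.V).U) :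
    M₁.fstU (t.coverU x) = (free K m M₁.V).fstU x := fstU_homU _ _ x

lemma sndU_coverU (t : Translate M M₁) (x : (free K m M₁.V).U) :
    M₁.sndU (t.coverU x) = t.π ((free K m M₁.V).sndU x) := sndU_homU _ _ x

lemma coverU_surjective (t : Translate M M₁) : Function.Surjective t.coverU := by
  intro x
  obtain ⟨f, hf⟩ := t.π_surjective (M₁.sndU x)
  refine ⟨(free K m M₁.V).inV (M₁.fstU x) + (free K m M₁.V).inN f, U_ext ?_ ?_⟩
  · exact (t.fstU_coverU _).trans (add_zero (M₁.fstU x))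
  · exact (t.sndU_coverU _).trans ((congrArg t.π (zero_add f)).trans hf)

lemma range_relU (t : Translate M M₁) : LinearMap.range t.relU = LinearMap.ker t.coverU := by
  ext x
  rw [LinearMap.mem_ker]
  constructor
  · rintro ⟨y, rfl⟩
    refine U_ext ?_ ?_
    · rw [fstU_coverU, fstU_relU, map_zero]
    · rw [sndU_coverU, sndU_relU, map_zero]
      exact t.π_ι _
  · intro hx
    have h₁ := t.fstU_coverU x
    have h₂ := t.sndU_coverU x
    rw [hx, map_zero] at h₁ h₂
    obtain ⟨n, hn⟩ := t.exists_ι_eq h₂.symm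
    refine ⟨M.tail.inN n, U_ext ?_ ?_⟩
    · rw [fstU_relU, h₁]
    · exact (t.sndU_relU _).trans hn

end Translate

lemma ExtVanish.exists_extension (h : ExtVanish M M') (hM' : M'.IsRetract) (hs' : M'.IsSeparated)
    (t : Translate M M₁) (t' : Translate M' M₁')
    (f : M.tail.U →ₗ[(LoopPowerAlgebra K (m + 1))ᵐᵒᵖ] M₁'.U) :
    ∃ f' : (free K m M₁.V).U →ₗ[(LoopPowerAlgebra K (m + 1))ᵐᵒᵖ] M₁'.U, f = f' ∘ₗ t.relU := by
  obtain ⟨X, Y, hβ, hj, rfl⟩ := exists_homU_eq f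
  obtain ⟨Z, hZ⟩ := h.exists_eq hM' hs' t t' Y hβ
  have hβ' (x) : t'.π (Cofree.map Z (Cofree.shift x)) = M₁'.β (t'.π (Cofree.map Z x)) := by
    rw [Cofree.map_shift, t'.π_shift]
  have hj' (v) : t'.π (Cofree.map Z (Cofree.gen v)) = M₁'.j (Z v) := by
    rw [Cofree.map_gen, t'.π_gen]
  refine ⟨homU (M := free K m M₁.V) Z (t'.π ∘ₗ Cofree.map Z) hβ' hj',
    LinearMap.ext fun x => U_ext ?_ ?_⟩
  · rw [fstU_homU, show M.tail.fstU x = 0 from rfl, map_zero]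
    refine Eq.symm ((fstU_homU hβ' hj' _).trans ?_)
    exact (congrArg Z (t.fstU_relU x)).trans (map_zero Z)
  · rw [sndU_homU]
    refine (hZ _).trans (Eq.symm ((sndU_homU hβ' hj' _).trans ?_))
    exact congrArg (t'.π ∘ₗ Cofree.map Z) (t.sndU_relU x)

lemma nontrivial_U (h : 0 < M.dimV + M.dimN) : Nontrivial M.U := by
  rw [← finrank_U] at h
  exact Module.nontrivial_of_finrank_pos (by exact_mod_cast h : 0 < Module.finrank K M.U)

lemma dimV_free : (free K m K).dimV = 1 := by
  have : Module.finrank K (free K m K).V = 1 := Module.finrank_self K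
  rw [dimV, this, Nat.cast_one]

lemma dimN_free : (free K m K).dimN = m + 1 := by
  have : Module.finrank K (free K m K).N = (m + 1) * Module.finrank K K := Cofree.finrank_eq
  rw [dimN, this, Module.finrank_self, mul_one, Nat.cast_add, Nat.cast_one]

lemma dimV_tail : M.tail.dimV = 0 := by
  have : Module.finrank K M.tail.V = 0 := Module.finrank_zero_of_subsingleton (M := PUnit)
  rw [dimV, this, Nat.cast_zero]

lemma dimN_tail : M.tail.dimN = M.dimN := rfl

lemma hasIndecClassCount_regular :
    HasIndecClassCount (LoopPowerAlgebra K (m + 1))ᵐᵒᵖ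
      (ModuleCat.of _ (LoopPowerAlgebra K (m + 1))ᵐᵒᵖ) 2 := by
  obtain ⟨e⟩ := exists_regular_equiv K m
  refine hasIndecClassCount_of_equiv_prod e
    (free_idempotentsTrivial.isIndecModule (nontrivial_U ?_))
    (tail_free_idempotentsTrivial.isIndecModule (nontrivial_U ?_)) ⟨fun f => ?_⟩
  · rw [dimV_free, dimN_free]; positivity
  · rw [dimV_tail, dimN_tail, dimN_free]; positivity
  · have := dim_eq_of_equiv f
    rw [dimV_tail, dimN_tail, dimV_free] at this
    omega

end LoopRep

open LoopRep

/-- A pair of representations whose direct sum is rigid. -/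
structure RigidPair (K : Type) [Field K] (m : ℕ) where
  /-- The first representation. -/
  X : LoopRep K m
  /-- The second representation. -/
  Y : LoopRep K m
  isRetract_X : X.IsRetract
  isRetract_Y : Y.IsRetract
  isSeparated_X : X.IsSeparated
  isSeparated_Y : Y.IsSeparated
  idempotentsTrivial_X : X.IdempotentsTrivial
  idempotentsTrivial_Y : Y.IdempotentsTrivial
  extVanish_XX : ExtVanish X X
  extVanish_XY : ExtVanish X Y
  extVanish_YX : ExtVanish Y X
  extVanish_YY : ExtVanish Y Y

namespace RigidPair

variable {K : Type} [Field K] {m : ℕ}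

variable (K) in
/-- The pair of indecomposable projectives. -/
def projectives (hm : 1 ≤ m) : RigidPair K m where
  X := free K m K
  Y := (free K m K).tail
  isRetract_X := free_isRetract K
  isRetract_Y := (free_isRetract K).tail
  isSeparated_X := free_isSeparated K hm
  isSeparated_Y := tail_isSeparated
  idempotentsTrivial_X := free_idempotentsTrivial
  idempotentsTrivial_Y := tail_free_idempotentsTrivial
  extVanish_XX := free_extVanish K
  extVanish_XY := free_extVanish K
  extVanish_YX := tail_extVanish
  extVanish_YY := tail_extVanish

/-- The pair of translates. -/
def translate (p : RigidPair K m) (hm : 3 ≤ m) {X₁ Y₁ : LoopRep K m} (s : Translate p.X X₁)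
    (t : Translate p.Y Y₁) : RigidPair K m where
  X := X₁
  Y := Y₁
  isRetract_X := p.isRetract_X.translate p.isSeparated_X s
  isRetract_Y := p.isRetract_Y.translate p.isSeparated_Y t
  isSeparated_X := p.isSeparated_X.translate hm s
  isSeparated_Y := p.isSeparated_Y.translate hm t
  idempotentsTrivial_X := p.idempotentsTrivial_X.translate p.isSeparated_X s
  idempotentsTrivial_Y := p.idempotentsTrivial_Y.translate p.isSeparated_Y t
  extVanish_XX := p.extVanish_XX.translate p.isRetract_X p.isSeparated_X s s
  extVanish_XY := p.extVanish_XY.translate p.isRetract_Y p.isSeparated_Y s t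
  extVanish_YX := p.extVanish_YX.translate p.isRetract_X p.isSeparated_X t s
  extVanish_YY := p.extVanish_YY.translate p.isRetract_Y p.isSeparated_Y t t

/-- The direct sum of the two modules. -/
abbrev module (p : RigidPair K m) : RMod (LoopPowerAlgebra K (m + 1)) :=
  ModuleCat.of _ (p.X.U × p.Y.U)

/-- The dimension of the direct sum. -/
def dim (p : RigidPair K m) : ℤ := p.X.dimV + p.X.dimN + (p.Y.dimV + p.Y.dimN)

lemma dim_eq_of_equiv {p p' : RigidPair K m}
    (e : p.module ≃ₗ[(LoopPowerAlgebra K (m + 1))ᵐᵒᵖ] p'.module) : p.dim = p'.dim := by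
  have h : Module.finrank K (p.X.U × p.Y.U) = Module.finrank K (p'.X.U × p'.Y.U) :=
    (LinearEquiv.restrictScalars K (M := p.X.U × p.Y.U) (M₂ := p'.X.U × p'.Y.U) e).finrank_eq
  rw [Module.finrank_prod, Module.finrank_prod] at h
  rw [dim, dim, ← finrank_U, ← finrank_U, ← finrank_U, ← finrank_U]
  exact_mod_cast h

lemma isBasicSupportTauTilting_translate (p : RigidPair K m) {X₁ Y₁ : LoopRep K m}
    (hm : 3 ≤ m) (s : Translate p.X X₁) (t : Translate p.Y Y₁) (hX : 0 < X₁.dimV + X₁.dimN)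
    (hXY : X₁.dimV + X₁.dimN < Y₁.dimV + Y₁.dimN) :
    IsBasicSupportTauTilting (LoopPowerAlgebra K (m + 1)) (p.translate hm s t).module := by
  have hX' := (p.translate hm s t).idempotentsTrivial_X.isIndecModule (nontrivial_U hX)
  have hY' := (p.translate hm s t).idempotentsTrivial_Y.isIndecModule
    (nontrivial_U (hX.trans hXY))
  have hne : IsEmpty (X₁.U ≃ₗ[(LoopPowerAlgebra K (m + 1))ᵐᵒᵖ] Y₁.U) :=
    ⟨fun e => hXY.ne (LoopRep.dim_eq_of_equiv e)⟩
  have := p.isRetract_X.projective_tail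
  have := p.isRetract_Y.projective_tail
  have := projective_free (K := K) (m := m) X₁.V
  have := projective_free (K := K) (m := m) Y₁.V
  refine ⟨⟨isTauRigidCat_prod s.relU s.coverU t.relU t.coverU
    s.coverU_surjective
    t.coverU_surjective s.range_relU t.range_relU
    (p.extVanish_XX.exists_extension p.isRetract_X p.isSeparated_X s s)
    (p.extVanish_XY.exists_extension p.isRetract_Y p.isSeparated_Y s t)
    (p.extVanish_YX.exists_extension p.isRetract_X p.isSeparated_X t s)
    (p.extVanish_YY.exists_extension p.isRetract_Y p.isSeparated_Y t t),
    ModuleCat.of _ PUnit, 2, 0, 2, inferInstanceAs (Module.Finite _ PUnit),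
    inferInstanceAs (Module.Projective _ PUnit),
    fun f => LinearMap.ext fun x => ?_,
    hasIndecClassCount_of_equiv_prod (LinearEquiv.refl _ _) hX' hY' hne,
    hasIndecClassCount_of_subsingleton, hasIndecClassCount_regular, rfl⟩,
    isBasicModuleCat_of_equiv_prod (LinearEquiv.refl _ _) hX' hY' hne⟩
  rw [show x = 0 from rfl, map_zero, map_zero]

/-- The dimension inequalities which propagate along translation. -/
def IsGrowing (p : RigidPair K m) : Prop :=
  0 ≤ p.X.dimV ∧ 2 * p.X.dimV < p.X.dimN ∧ p.X.dimV < p.Y.dimV ∧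
    2 * (p.Y.dimV - p.X.dimV) ≤ p.Y.dimN - p.X.dimN

lemma IsGrowing.exists_translate {p : RigidPair K m} (hp : p.IsGrowing) (hm : 3 ≤ m) :
    ∃ p' : RigidPair K m, p'.IsGrowing ∧ p.dim < p'.dim ∧
      IsBasicSupportTauTilting (LoopPowerAlgebra K (m + 1)) p'.module := by
  obtain ⟨X₁, ⟨s⟩⟩ := LoopRep.exists_translate p.X
  obtain ⟨Y₁, ⟨t⟩⟩ := LoopRep.exists_translate p.Y
  obtain ⟨h₁, h₂, h₃, h₄⟩ := hp
  have hX := p.isSeparated_X.dimV_translate s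
  have hY := p.isSeparated_Y.dimV_translate t
  have hX' := p.isSeparated_X.dimN_translate s
  have hY' := p.isSeparated_Y.dimN_translate t
  have hm' : (3 : ℤ) ≤ m := by exact_mod_cast hm
  have h₅ : 0 ≤ ((m : ℤ) - 3) * X₁.dimV := mul_nonneg (by linarith) (by linarith)
  have h₆ : 0 ≤ ((m : ℤ) - 3) * (Y₁.dimV - X₁.dimV) := mul_nonneg (by linarith) (by linarith)
  refine ⟨p.translate hm s t, ⟨?_, ?_, ?_, ?_⟩, ?_,
    p.isBasicSupportTauTilting_translate hm s t (by linarith) (by linarith)⟩ <;>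
    simp only [translate, dim] <;> linarith

lemma exists_isGrowing (hm : 3 ≤ m) : ∃ p : RigidPair K m, p.IsGrowing := by
  obtain ⟨X₁, ⟨s⟩⟩ := LoopRep.exists_translate (free K m K)
  obtain ⟨Y₁, ⟨t⟩⟩ := LoopRep.exists_translate (free K m K).tail
  let p : RigidPair K m := projectives K (by omega)
  have hX := p.isSeparated_X.dimV_translate s
  have hY := p.isSeparated_Y.dimV_translate t
  have hX' := p.isSeparated_X.dimN_translate s
  have hY' := p.isSeparated_Y.dimN_translate t
  simp only [p, projectives, dimN_tail, dimV_tail, dimV_free, dimN_free] at hX hY hX' hY'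
  refine ⟨p.translate hm s t, ?_, ?_, ?_, ?_⟩ <;> simp only [translate] <;>
    have hm : (3 : ℤ) ≤ m := by exact_mod_cast hm
  all_goals
    rw [hX, hY] at *
    nlinarith

lemma exists_seq (hm : 3 ≤ m) : ∃ p : ℕ → RigidPair K m, StrictMono (fun n => (p n).dim) ∧
    ∀ n, IsBasicSupportTauTilting (LoopPowerAlgebra K (m + 1)) (p n).module := by
  obtain ⟨p₀, hp₀⟩ := exists_isGrowing (K := K) hm
  choose f hf using fun p : {p : RigidPair K m // p.IsGrowing} => p.2.exists_translate hm
  let q : ℕ → {p : RigidPair K m // p.IsGrowing} :=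
    fun n => (fun p => ⟨f p, (hf p).1⟩)^[n] ⟨p₀, hp₀⟩
  refine ⟨fun n => f (q n), strictMono_nat_of_lt_succ fun n => ?_, fun n => (hf _).2.2⟩
  have : q (n + 1) = ⟨f (q n), (hf (q n)).1⟩ := Function.iterate_succ_apply' _ _ _
  simp only [this]
  exact (hf ⟨f (q n), (hf (q n)).1⟩).2.1

end RigidPair

/-- Remark 3.3(ii).  If `ℓ ≥ 4` then `KQ/(βˡ)` is τ-tilting
infinite. -/
theorem loopPowerAlgebra_tau_tilting_infinite (K : Type) [Field K] [IsAlgClosed K]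
    (l : ℕ) (hl : 4 ≤ l) : ¬ IsTauTiltingFinite (LoopPowerAlgebra K l) := by
  obtain ⟨m, rfl⟩ : ∃ m, l = m + 1 := ⟨l - 1, by omega⟩
  rintro ⟨n, L, hL⟩
  obtain ⟨p, hp, hτ⟩ := RigidPair.exists_seq (K := K) (show 3 ≤ m by omega)
  choose i e using fun k => hL _ (hτ k)
  obtain ⟨a, b, hab, h⟩ := Finite.exists_ne_map_eq_of_infinite i
  obtain ⟨f⟩ := e a
  obtain ⟨g⟩ : Nonempty ((p b).module ≃ₗ[(LoopPowerAlgebra K (m + 1))ᵐᵒᵖ] L (i a)) := h ▸ e b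
  exact hab (hp.injective (RigidPair.dim_eq_of_equiv (f.trans g.symm)))

end TwoPoint
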